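/- arXiv:2105.07565 — 12 statements merged into one kernel-verified Lean document; each statement's English description precedes it below -/
import Mathlib

section
/- Fix α ∈ (0,1)∪(1,∞), a prior μ with μ(ω) > 0 for all ω ∈ Ω, and a statistical experiment P such that μP_S(s) > 0 for every s ∈ S. Then for every probability vector q on S with q(s) > 0 for all s, one has (1/(α−1))·log Σ_{ω∈Ω} Σ_{s∈S} μ(ω)·P(s|ω)^α·q(s)^{1−α} ≥ I_α(P,μ), and equality holds for the barycenter q*(s) := (Σ_{ω} μ(ω)P(s|ω)^α)^{1/α} / Σ_{s'∈S} (Σ_{ω} μ(ω)P(s'|ω)^α)^{1/α}. In particular, the infimum over such q of (1/(α−1))·log Σ_{ω,s} μ(ω)P(s|ω)^α q(s)^{1−α} equals (α/(α−1))·log Σ_{s∈S} (Σ_{ω∈Ω} μ(ω)P(s|ω)^α)^{1/α}. -/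
open Real Finset

/-- A prior: a probability vector on a finite set of states. -/
def IsPrior {Ω : Type*} [Fintype Ω] (μ : Ω → ℝ) : Prop :=
  (∀ ω, 0 ≤ μ ω) ∧ ∑ ω, μ ω = 1

/-- A statistical experiment: a Markov kernel from states to signals. -/
def IsExperiment {Ω S : Type*} [Fintype Ω] [Fintype S] (P : Ω → S → ℝ) : Prop :=
  (∀ ω s, 0 ≤ P ω s) ∧ ∀ ω, ∑ s, P ω s = 1

/-- The α-mutual information `I_α(P, μ)`. -/
noncomputable def alphaMI {Ω S : Type*} [Fintype Ω] [Fintype S]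
    (α : ℝ) (P : Ω → S → ℝ) (μ : Ω → ℝ) : ℝ :=
  (α / (α - 1)) * Real.log (∑ s, (∑ ω, μ ω * P ω s ^ α) ^ (1 / α))

/-- A lower bound, uniform in the probability vector `q`, for the order-`α` log-power functional
of `a` relative to `q`. -/
theorem mul_log_sum_le_log_sum_rpow_mul {S : Type*} [Fintype S] [Nonempty S]
    {α : ℝ} (hα0 : 0 < α) (hα1 : α ≠ 1) {a q : S → ℝ} (ha : ∀ s, 0 < a s)
    (hq : ∀ s, 0 < q s) (hq1 : ∑ s, q s = 1) :
    (α / (α - 1)) * Real.log (∑ s, a s) ≤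
      (1 / (α - 1)) * Real.log (∑ s, a s ^ α * q s ^ (1 - α)) := by
  have hz : ∀ s ∈ univ, 0 ≤ a s / q s := fun s _ => (div_pos (ha s) (hq s)).le
  have hmean : ∑ s, q s * (a s / q s) = ∑ s, a s :=
    sum_congr rfl fun s _ => mul_div_cancel₀ _ (hq s).ne'
  have hpow : ∑ s, q s * (a s / q s) ^ α = ∑ s, a s ^ α * q s ^ (1 - α) := by
    refine sum_congr rfl fun s _ => ?_
    rw [div_rpow (ha s).le (hq s).le, rpow_sub (hq s), rpow_one]
    ring
  have hsum : 0 < ∑ s, a s := sum_pos (fun s _ => ha s) univ_nonempty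
  have hsum' : 0 < ∑ s, a s ^ α * q s ^ (1 - α) :=
    sum_pos (fun s _ => mul_pos (rpow_pos_of_pos (ha s) _) (rpow_pos_of_pos (hq s) _))
      univ_nonempty
  rw [div_mul_eq_mul_div, div_mul_eq_mul_div, one_mul, ← log_rpow hsum]
  rcases lt_or_gt_of_ne hα1 with h | h
  · have key := (concaveOn_rpow hα0.le h.le).le_map_sum (fun s _ => (hq s).le) hq1 hz
    simp only [smul_eq_mul, hmean, hpow] at key
    exact div_le_div_of_nonpos_of_le (by linarith) (log_le_log hsum' key)
  · have key := rpow_arith_mean_le_arith_mean_rpow univ q (fun s => a s / q s)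
      (fun s _ => (hq s).le) hq1 hz h.le
    simp only [hmean, hpow] at key
    exact div_le_div_of_nonneg_right (log_le_log (rpow_pos_of_pos hsum _) key) (by linarith)

/-- The value of the order-`α` log-power functional of `a` at the normalization of `a`. -/
theorem log_sum_rpow_mul_normalized {S : Type*} [Fintype S] [Nonempty S]
    {α : ℝ} {a : S → ℝ} (ha : ∀ s, 0 < a s) :
    Real.log (∑ s, a s ^ α * (a s / ∑ s', a s') ^ (1 - α)) = α * Real.log (∑ s, a s) := by
  have hsum : 0 < ∑ s, a s := sum_pos (fun s _ => ha s) univ_nonempty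
  rw [← log_rpow hsum]
  congr 1
  calc ∑ s, a s ^ α * (a s / ∑ s', a s') ^ (1 - α)
      = ∑ s, a s / (∑ s', a s') ^ (1 - α) := by
        refine sum_congr rfl fun s _ => ?_
        rw [div_rpow (ha s).le hsum.le, mul_div_assoc', ← rpow_add (ha s),
          add_sub_cancel, rpow_one]
    _ = (∑ s, a s) ^ α := by
        rw [← sum_div, div_eq_iff (rpow_pos_of_pos hsum _).ne', ← rpow_add hsum,
          add_sub_cancel, rpow_one]

theorem alphaMI_eq_min_over_barycenters
    {Ω S : Type*} [Fintype Ω] [Fintype S]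
    (α : ℝ) (hα0 : 0 < α) (hα1 : α ≠ 1)
    (μ : Ω → ℝ) (hμ : IsPrior μ) (hμpos : ∀ ω, 0 < μ ω)
    (P : Ω → S → ℝ) (hP : IsExperiment P)
    (hmarg : ∀ s, 0 < ∑ ω, μ ω * P ω s) :
    (∀ q : S → ℝ, (∀ s, 0 < q s) → (∑ s, q s) = 1 →
      alphaMI α P μ ≤
        (1 / (α - 1)) * Real.log (∑ ω, ∑ s, μ ω * P ω s ^ α * q s ^ (1 - α))) ∧
    ((1 / (α - 1)) * Real.log (∑ ω, ∑ s, μ ω * P ω s ^ α *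
        ((∑ ω', μ ω' * P ω' s ^ α) ^ (1 / α) /
          ∑ s', (∑ ω', μ ω' * P ω' s' ^ α) ^ (1 / α)) ^ (1 - α))
      = alphaMI α P μ) ∧
    sInf {x : ℝ | ∃ q : S → ℝ, (∀ s, 0 < q s) ∧ (∑ s, q s) = 1 ∧
        x = (1 / (α - 1)) * Real.log (∑ ω, ∑ s, μ ω * P ω s ^ α * q s ^ (1 - α))}
      = alphaMI α P μ := by
  have : Nonempty Ω := by
    by_contra h
    rw [not_nonempty_iff] at h
    simpa using hμ.2
  have : Nonempty S := by
    by_contra h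
    rw [not_nonempty_iff] at h
    simpa using hP.2 (Classical.arbitrary Ω)
  have hm : ∀ s, 0 < ∑ ω, μ ω * P ω s ^ α := by
    intro s
    obtain ⟨ω, -, hω⟩ := exists_lt_of_sum_lt (s := univ) (f := fun _ : Ω => (0 : ℝ))
      (by simpa using hmarg s)
    exact sum_pos' (fun ω _ => mul_nonneg (hμ.1 ω) (rpow_nonneg (hP.1 ω s) _))
      ⟨ω, mem_univ _, mul_pos (hμpos ω)
        (rpow_pos_of_pos (pos_of_mul_pos_right hω (hμ.1 ω)) _)⟩
  unfold alphaMI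
  have hswap : ∀ q : S → ℝ, ∑ ω, ∑ s, μ ω * P ω s ^ α * q s ^ (1 - α) =
      ∑ s, ((∑ ω, μ ω * P ω s ^ α) ^ (1 / α)) ^ α * q s ^ (1 - α) := by
    intro q
    rw [sum_comm]
    refine sum_congr rfl fun s _ => ?_
    rw [← rpow_mul (hm s).le, one_div_mul_cancel hα0.ne', rpow_one, sum_mul]
  simp only [hswap]
  have ha : ∀ s, 0 < (∑ ω, μ ω * P ω s ^ α) ^ (1 / α) := fun s => rpow_pos_of_pos (hm s) _
  obtain ⟨a, hadef⟩ : ∃ a : S → ℝ, ∀ s, (∑ ω, μ ω * P ω s ^ α) ^ (1 / α) = a s :=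
    ⟨_, fun _ => rfl⟩
  simp only [hadef] at ha ⊢
  have hsum : 0 < ∑ s, a s := sum_pos (fun s _ => ha s) univ_nonempty
  have hle := fun (q : S → ℝ) hq hq1 =>
    mul_log_sum_le_log_sum_rpow_mul (q := q) hα0 hα1 ha hq hq1
  have heq : (1 / (α - 1)) * Real.log (∑ s, a s ^ α * (a s / ∑ s', a s') ^ (1 - α)) =
      (α / (α - 1)) * Real.log (∑ s, a s) := by
    rw [log_sum_rpow_mul_normalized ha]
    ring
  refine ⟨hle, heq, IsLeast.csInf_eq ⟨⟨fun s => a s / ∑ s', a s', fun s => div_pos (ha s) hsum,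
    ?_, heq.symm⟩, ?_⟩⟩
  · rw [← sum_div, div_self hsum.ne']
  · rintro _ ⟨q, hq, hq1, rfl⟩
    exact hle q hq hq1
end

section
/- Fix α ∈ (0,1)∪(1,∞) and a prior μ with μ(ω) > 0 for all ω ∈ Ω. Then the map φ_μ : Δ(Ω) → ℝ defined on the probability simplex by φ_μ(γ) := (1/(α−1))·(Σ_{ω∈Ω} γ(ω)^α · μ(ω)^{1−α})^{1/α} is convex, i.e. φ_μ(t·γ₀ + (1−t)·γ₁) ≤ t·φ_μ(γ₀) + (1−t)·φ_μ(γ₁) for all probability vectors γ₀, γ₁ on Ω and all t ∈ [0,1]. -/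
open Real Finset

/-- **Reverse Minkowski inequality**: for `0 < p ≤ 1` the `L_p` functional is superadditive on
nonnegative vectors. -/
theorem Lp_add_Lp_le_of_nonneg {ι : Type*} (s : Finset ι) {f g : ι → ℝ} {p : ℝ}
    (hp0 : 0 < p) (hp1 : p ≤ 1) (hf : ∀ i ∈ s, 0 ≤ f i) (hg : ∀ i ∈ s, 0 ≤ g i) :
    (∑ i ∈ s, f i ^ p) ^ (1 / p) + (∑ i ∈ s, g i ^ p) ^ (1 / p)
      ≤ (∑ i ∈ s, (f i + g i) ^ p) ^ (1 / p) := by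
  have hF : 0 ≤ ∑ i ∈ s, f i ^ p := sum_nonneg fun i hi => rpow_nonneg (hf i hi) p
  have hG : 0 ≤ ∑ i ∈ s, g i ^ p := sum_nonneg fun i hi => rpow_nonneg (hg i hi) p
  have hip : 1 / p ≠ 0 := by positivity
  rcases hF.eq_or_lt with hF0 | hFpos
  · rw [← hF0, zero_rpow hip, zero_add]
    refine rpow_le_rpow hG (sum_le_sum fun i hi => ?_) (by positivity)
    exact rpow_le_rpow (hg i hi) (le_add_of_nonneg_left (hf i hi)) hp0.le
  rcases hG.eq_or_lt with hG0 | hGpos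
  · rw [← hG0, zero_rpow hip, add_zero]
    refine rpow_le_rpow hF (sum_le_sum fun i hi => ?_) (by positivity)
    exact rpow_le_rpow (hf i hi) (le_add_of_nonneg_right (hg i hi)) hp0.le
  have hAp : ((∑ i ∈ s, f i ^ p) ^ (1 / p)) ^ p = ∑ i ∈ s, f i ^ p := by
    rw [← rpow_mul hF, one_div_mul_cancel hp0.ne', rpow_one]
  have hBp : ((∑ i ∈ s, g i ^ p) ^ (1 / p)) ^ p = ∑ i ∈ s, g i ^ p := by
    rw [← rpow_mul hG, one_div_mul_cancel hp0.ne', rpow_one]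
  have hA : 0 < (∑ i ∈ s, f i ^ p) ^ (1 / p) := rpow_pos_of_pos hFpos _
  have hB : 0 < (∑ i ∈ s, g i ^ p) ^ (1 / p) := rpow_pos_of_pos hGpos _
  set A := (∑ i ∈ s, f i ^ p) ^ (1 / p)
  set B := (∑ i ∈ s, g i ^ p) ^ (1 / p)
  have hAB : 0 < A + B := add_pos hA hB
  have concave : ∀ i ∈ s, A / (A + B) * (f i ^ p / A ^ p) + B / (A + B) * (g i ^ p / B ^ p)
      ≤ (f i + g i) ^ p / (A + B) ^ p := fun i hi => by
    have h := (concaveOn_rpow hp0.le hp1).2 (Set.mem_Ici.2 (div_nonneg (hf i hi) hA.le))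
      (Set.mem_Ici.2 (div_nonneg (hg i hi) hB.le)) (div_nonneg hA.le hAB.le)
      (div_nonneg hB.le hAB.le) (by field_simp)
    have e : A / (A + B) * (f i / A) + B / (A + B) * (g i / B) = (f i + g i) / (A + B) := by
      field_simp
    simp only [smul_eq_mul] at h
    rwa [e, div_rpow (hf i hi) hA.le, div_rpow (hg i hi) hB.le,
      div_rpow (add_nonneg (hf i hi) (hg i hi)) hAB.le] at h
  have h := sum_le_sum concave
  rw [sum_add_distrib, ← mul_sum, ← mul_sum, ← sum_div, ← sum_div, ← sum_div, hAp, hBp,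
    div_self hFpos.ne', div_self hGpos.ne', mul_one, mul_one, ← add_div, div_self hAB.ne',
    one_le_div (rpow_pos_of_pos hAB p)] at h
  calc A + B = ((A + B) ^ p) ^ (1 / p) := by
        rw [← rpow_mul hAB.le, mul_one_div_cancel hp0.ne', rpow_one]
    _ ≤ _ := rpow_le_rpow (by positivity) h (by positivity)

theorem Lp_const_mul_of_nonneg {ι : Type*} (s : Finset ι) {f : ι → ℝ} {p c : ℝ}
    (hp : p ≠ 0) (hc : 0 ≤ c) (hf : ∀ i ∈ s, 0 ≤ f i) :
    (∑ i ∈ s, (c * f i) ^ p) ^ (1 / p) = c * (∑ i ∈ s, f i ^ p) ^ (1 / p) := by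
  rw [sum_congr rfl fun i hi => mul_rpow hc (hf i hi), ← mul_sum,
    mul_rpow (rpow_nonneg hc p) (sum_nonneg fun i hi => rpow_nonneg (hf i hi) p),
    ← rpow_mul hc, mul_one_div_cancel hp, rpow_one]

theorem phi_mu_convex
    {Ω : Type*} [Fintype Ω]
    (α : ℝ) (hα0 : 0 < α) (hα1 : α ≠ 1)
    (μ : Ω → ℝ) (hμ : IsPrior μ) (hμpos : ∀ ω, 0 < μ ω)
    (γ₀ γ₁ : Ω → ℝ) (hγ₀ : IsPrior γ₀) (hγ₁ : IsPrior γ₁)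
    (t : ℝ) (ht : t ∈ Set.Icc (0 : ℝ) 1) :
    (1 / (α - 1)) * (∑ ω, (t * γ₀ ω + (1 - t) * γ₁ ω) ^ α * μ ω ^ (1 - α)) ^ (1 / α)
      ≤ t * ((1 / (α - 1)) * (∑ ω, γ₀ ω ^ α * μ ω ^ (1 - α)) ^ (1 / α))
        + (1 - t) * ((1 / (α - 1)) * (∑ ω, γ₁ ω ^ α * μ ω ^ (1 - α)) ^ (1 / α)) := by
  have ht0 : 0 ≤ t := ht.1
  have ht1 : 0 ≤ 1 - t := sub_nonneg.2 ht.2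
  have hw : ∀ ω, 0 ≤ μ ω ^ ((1 - α) / α) := fun ω => rpow_nonneg (hμpos ω).le _
  have weight : ∀ x : ℝ, 0 ≤ x → ∀ ω,
      x ^ α * μ ω ^ (1 - α) = (x * μ ω ^ ((1 - α) / α)) ^ α := fun x hx ω => by
    rw [mul_rpow hx (hw ω), ← rpow_mul (hμpos ω).le, div_mul_cancel₀ _ hα0.ne']
  have h₀ : ∀ ω ∈ univ, 0 ≤ γ₀ ω * μ ω ^ ((1 - α) / α) :=
    fun ω _ => mul_nonneg (hγ₀.1 ω) (hw ω)
  have h₁ : ∀ ω ∈ univ, 0 ≤ γ₁ ω * μ ω ^ ((1 - α) / α) :=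
    fun ω _ => mul_nonneg (hγ₁.1 ω) (hw ω)
  rw [sum_congr rfl fun ω _ => weight _ (hγ₀.1 ω) ω,
    sum_congr rfl fun ω _ => weight _ (hγ₁.1 ω) ω,
    sum_congr rfl fun ω _ => weight _
      (add_nonneg (mul_nonneg ht0 (hγ₀.1 ω)) (mul_nonneg ht1 (hγ₁.1 ω))) ω,
    mul_left_comm t, mul_left_comm (1 - t), ← mul_add,
    ← Lp_const_mul_of_nonneg univ hα0.ne' ht0 h₀, ← Lp_const_mul_of_nonneg univ hα0.ne' ht1 h₁]
  simp only [add_mul, mul_assoc]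
  have h₀' : ∀ ω ∈ univ, 0 ≤ t * (γ₀ ω * μ ω ^ ((1 - α) / α)) :=
    fun ω hω => mul_nonneg ht0 (h₀ ω hω)
  have h₁' : ∀ ω ∈ univ, 0 ≤ (1 - t) * (γ₁ ω * μ ω ^ ((1 - α) / α)) :=
    fun ω hω => mul_nonneg ht1 (h₁ ω hω)
  rcases hα1.lt_or_gt with hlt | hgt
  · exact mul_le_mul_of_nonpos_left (Lp_add_Lp_le_of_nonneg univ hα0 hlt.le h₀' h₁')
      (one_div_nonpos.2 (sub_nonpos.2 hlt.le))
  · exact mul_le_mul_of_nonneg_left (Lp_add_le_of_nonneg univ hgt.le h₀' h₁')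
      (one_div_nonneg.2 (sub_nonneg.2 hgt.le))
end

section
/- Fix α ∈ (0,1)∪(1,∞) and a prior μ with μ(ω) > 0 for all ω ∈ Ω. Let P and Q be statistical experiments from Ω to finite signal sets S_P and S_Q respectively, and suppose P is Blackwell more informative than Q under μ, in the sense that for every convex function φ : Δ(Ω) → ℝ one has Σ_{s∈S_P: μP_S(s)>0} μP_S(s)·φ(γ_P^s) ≥ Σ_{s∈S_Q: μQ_S(s)>0} μQ_S(s)·φ(γ_Q^s), where γ_P^s(ω) := μ(ω)P(s|ω)/μP_S(s) and γ_Q^s(ω) := μ(ω)Q(s|ω)/μQ_S(s) are the induced posteriors. Then I_α(P,μ) ≥ I_α(Q,μ). -/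
open Real Finset

/-- Reverse Minkowski inequality for exponents in `(0, 1)`. -/
theorem Lp_add_le_of_lt_one {Ω : Type*} [Fintype Ω] {α : ℝ} (h0 : 0 < α) (h1 : α < 1)
    {x y : Ω → ℝ} (hx : ∀ ω, 0 ≤ x ω) (hy : ∀ ω, 0 ≤ y ω) :
    (∑ ω, x ω ^ α) ^ (1 / α) + (∑ ω, y ω ^ α) ^ (1 / α) ≤
      (∑ ω, (x ω + y ω) ^ α) ^ (1 / α) := by
  have hXs : 0 ≤ ∑ ω, x ω ^ α := sum_nonneg fun ω _ => rpow_nonneg (hx ω) _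
  have hYs : 0 ≤ ∑ ω, y ω ^ α := sum_nonneg fun ω _ => rpow_nonneg (hy ω) _
  have hα : 0 ≤ 1 / α := by positivity
  have hX : ((∑ ω, x ω ^ α) ^ (1 / α)) ^ α = ∑ ω, x ω ^ α := by
    rw [← rpow_mul hXs, one_div_mul_cancel h0.ne', rpow_one]
  have hY : ((∑ ω, y ω ^ α) ^ (1 / α)) ^ α = ∑ ω, y ω ^ α := by
    rw [← rpow_mul hYs, one_div_mul_cancel h0.ne', rpow_one]
  have hA0 : 0 ≤ (∑ ω, x ω ^ α) ^ (1 / α) := rpow_nonneg hXs _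
  have hB0 : 0 ≤ (∑ ω, y ω ^ α) ^ (1 / α) := rpow_nonneg hYs _
  rcases hA0.eq_or_lt with hA | hA
  · rw [← hA, zero_add]
    refine rpow_le_rpow hYs (sum_le_sum fun ω _ => ?_) hα
    exact rpow_le_rpow (hy ω) (le_add_of_nonneg_left (hx ω)) h0.le
  rcases hB0.eq_or_lt with hB | hB
  · rw [← hB, add_zero]
    refine rpow_le_rpow hXs (sum_le_sum fun ω _ => ?_) hα
    exact rpow_le_rpow (hx ω) (le_add_of_nonneg_right (hy ω)) h0.le
  generalize (∑ ω, x ω ^ α) ^ (1 / α) = A at *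
  generalize (∑ ω, y ω ^ α) ^ (1 / α) = B at *
  have hAB : 0 < A + B := by positivity
  have key : (A + B) ^ α ≤ ∑ ω, (x ω + y ω) ^ α := by
    have hpt : ∀ ω, (A + B) ^ α * (A / (A + B) * (x ω ^ α / A ^ α) +
        B / (A + B) * (y ω ^ α / B ^ α)) ≤ (x ω + y ω) ^ α := by
      intro ω
      have hc := (Real.concaveOn_rpow h0.le h1.le).2
        (Set.mem_Ici.2 (div_nonneg (hx ω) hA.le)) (Set.mem_Ici.2 (div_nonneg (hy ω) hB.le))
        (div_nonneg hA.le hAB.le) (div_nonneg hB.le hAB.le)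
        (by rw [← add_div, div_self hAB.ne'])
      simp only [smul_eq_mul] at hc
      rw [div_rpow (hx ω) hA.le, div_rpow (hy ω) hB.le] at hc
      have he : A / (A + B) * (x ω / A) + B / (A + B) * (y ω / B) =
          (x ω + y ω) / (A + B) := by field_simp
      rw [he, div_rpow (add_nonneg (hx ω) (hy ω)) hAB.le,
        le_div_iff₀ (rpow_pos_of_pos hAB _)] at hc
      rwa [mul_comm]
    refine le_trans (le_of_eq ?_) (sum_le_sum fun ω _ => hpt ω)
    rw [← mul_sum, sum_add_distrib, ← mul_sum, ← mul_sum, ← sum_div, ← sum_div, ← hX, ← hY,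
      div_self (rpow_pos_of_pos hA _).ne', div_self (rpow_pos_of_pos hB _).ne', mul_one, mul_one,
      ← add_div, div_self hAB.ne', mul_one]
  calc A + B = ((A + B) ^ α) ^ (1 / α) := by
        rw [← rpow_mul hAB.le, mul_one_div_cancel h0.ne', rpow_one]
    _ ≤ _ := rpow_le_rpow (rpow_nonneg hAB.le _) key hα

/-- The `Lp` functional is positively homogeneous. -/
theorem Lp_const_mul {Ω : Type*} [Fintype Ω] {α : ℝ} (h0 : 0 < α) {a : ℝ} (ha : 0 ≤ a)
    {x : Ω → ℝ} (hx : ∀ ω, 0 ≤ x ω) :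
    (∑ ω, (a * x ω) ^ α) ^ (1 / α) = a * (∑ ω, x ω ^ α) ^ (1 / α) := by
  simp_rw [fun ω => mul_rpow (z := α) ha (hx ω)]
  rw [← mul_sum, mul_rpow (rpow_nonneg ha _) (sum_nonneg fun ω _ => rpow_nonneg (hx ω) _),
    ← rpow_mul ha, mul_one_div_cancel h0.ne', rpow_one]

/-- The weighted `Lp` functional is convex on the simplex for exponents at least one. -/
theorem convexOn_weighted_Lp {Ω : Type*} [Fintype Ω] {α : ℝ} (h1 : 1 ≤ α)
    {c : Ω → ℝ} (hc : ∀ ω, 0 ≤ c ω) :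
    ConvexOn ℝ (stdSimplex ℝ Ω) fun x => (∑ ω, (c ω * x ω) ^ α) ^ (1 / α) := by
  have h0 : 0 < α := by linarith
  refine ⟨convex_stdSimplex ℝ Ω, fun x hx y hy a b ha hb _ => ?_⟩
  have hx' : ∀ ω, 0 ≤ c ω * x ω := fun ω => mul_nonneg (hc ω) (hx.1 ω)
  have hy' : ∀ ω, 0 ≤ c ω * y ω := fun ω => mul_nonneg (hc ω) (hy.1 ω)
  simp only [smul_eq_mul, Pi.add_apply, Pi.smul_apply]
  rw [← Lp_const_mul h0 ha hx', ← Lp_const_mul h0 hb hy']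
  simp_rw [fun ω => show c ω * (a * x ω + b * y ω) = a * (c ω * x ω) + b * (c ω * y ω) by ring]
  exact Real.Lp_add_le_of_nonneg (s := univ) h1 (fun ω _ => mul_nonneg ha (hx' ω))
    (fun ω _ => mul_nonneg hb (hy' ω))

/-- The weighted `Lp` functional is concave on the simplex for exponents in `(0, 1)`. -/
theorem concaveOn_weighted_Lp {Ω : Type*} [Fintype Ω] {α : ℝ} (h0 : 0 < α) (h1 : α < 1)
    {c : Ω → ℝ} (hc : ∀ ω, 0 ≤ c ω) :
    ConcaveOn ℝ (stdSimplex ℝ Ω) fun x => (∑ ω, (c ω * x ω) ^ α) ^ (1 / α) := by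
  refine ⟨convex_stdSimplex ℝ Ω, fun x hx y hy a b ha hb _ => ?_⟩
  have hx' : ∀ ω, 0 ≤ c ω * x ω := fun ω => mul_nonneg (hc ω) (hx.1 ω)
  have hy' : ∀ ω, 0 ≤ c ω * y ω := fun ω => mul_nonneg (hc ω) (hy.1 ω)
  simp only [smul_eq_mul, Pi.add_apply, Pi.smul_apply]
  rw [← Lp_const_mul h0 ha hx', ← Lp_const_mul h0 hb hy']
  simp_rw [fun ω => show c ω * (a * x ω + b * y ω) = a * (c ω * x ω) + b * (c ω * y ω) by ring]
  exact Lp_add_le_of_lt_one h0 h1 (fun ω => mul_nonneg ha (hx' ω))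
    (fun ω => mul_nonneg hb (hy' ω))

/-- The contribution of one signal to the `α`-mutual information, in terms of its posterior. -/
theorem posterior_Lp_eq {Ω : Type*} [Fintype Ω] {α : ℝ} (h0 : 0 < α) {μ : Ω → ℝ}
    (hμpos : ∀ ω, 0 < μ ω) {p : Ω → ℝ} (hp : ∀ ω, 0 ≤ p ω) :
    (if 0 < ∑ ω, μ ω * p ω then
        (∑ ω, μ ω * p ω) *
          (∑ ω, (μ ω ^ (1 / α) / μ ω * (μ ω * p ω / ∑ ω', μ ω' * p ω')) ^ α) ^ (1 / α)
      else 0) = (∑ ω, μ ω * p ω ^ α) ^ (1 / α) := by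
  have hmul : ∀ ω, 0 ≤ μ ω * p ω := fun ω => mul_nonneg (hμpos ω).le (hp ω)
  split_ifs with hm
  · rw [← Lp_const_mul h0 hm.le fun ω => mul_nonneg
      (div_nonneg (rpow_nonneg (hμpos ω).le _) (hμpos ω).le) (div_nonneg (hmul ω) hm.le)]
    congr 1
    refine sum_congr rfl fun ω _ => ?_
    have hμω := (hμpos ω).ne'
    have hm' := hm.ne'
    have he : (∑ ω, μ ω * p ω) * (μ ω ^ (1 / α) / μ ω * (μ ω * p ω / ∑ ω', μ ω' * p ω')) =
        μ ω ^ (1 / α) * p ω := by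
      generalize (∑ ω, μ ω * p ω) = m at *
      field_simp
    rw [he, mul_rpow (rpow_nonneg (hμpos ω).le _) (hp ω), ← rpow_mul (hμpos ω).le,
      one_div_mul_cancel h0.ne', rpow_one]
  · have hz : ∑ ω, μ ω * p ω = 0 := le_antisymm (not_lt.1 hm) (sum_nonneg fun ω _ => hmul ω)
    have hp0 : ∀ ω, p ω = 0 := fun ω => by
      have := (sum_eq_zero_iff_of_nonneg fun ω _ => hmul ω).1 hz ω (mem_univ ω)
      exact (mul_eq_zero.1 this).resolve_left (hμpos ω).ne'
    simp [hp0, zero_rpow h0.ne', zero_rpow (inv_ne_zero h0.ne')]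

/-- The argument of the logarithm in the `α`-mutual information is positive. -/
theorem alphaMI_arg_pos {Ω S : Type*} [Fintype Ω] [Fintype S] (α : ℝ)
    {μ : Ω → ℝ} (hμ : IsPrior μ) (hμpos : ∀ ω, 0 < μ ω) {P : Ω → S → ℝ} (hP : IsExperiment P) :
    0 < ∑ s, (∑ ω, μ ω * P ω s ^ α) ^ (1 / α) := by
  have hterm : ∀ ω s, 0 ≤ μ ω * P ω s ^ α := fun ω s =>
    mul_nonneg (hμpos ω).le (rpow_nonneg (hP.1 ω s) _)
  obtain ⟨ω, -, -⟩ : ∃ ω ∈ univ, μ ω ≠ 0 :=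
    exists_ne_zero_of_sum_ne_zero (by rw [hμ.2]; exact one_ne_zero)
  obtain ⟨s, -, hs⟩ : ∃ s ∈ univ, P ω s ≠ 0 :=
    exists_ne_zero_of_sum_ne_zero (by rw [hP.2 ω]; exact one_ne_zero)
  refine sum_pos' (fun s _ => rpow_nonneg (sum_nonneg fun ω _ => hterm ω s) _)
    ⟨s, mem_univ s, rpow_pos_of_pos (sum_pos' (fun ω _ => hterm ω s) ⟨ω, mem_univ ω, ?_⟩) _⟩
  exact mul_pos (hμpos ω) (rpow_pos_of_pos ((hP.1 ω s).lt_of_ne' hs) _)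

theorem alphaMI_blackwell_monotone
    {Ω SP SQ : Type*} [Fintype Ω] [Fintype SP] [Fintype SQ]
    (α : ℝ) (hα0 : 0 < α) (hα1 : α ≠ 1)
    (μ : Ω → ℝ) (hμ : IsPrior μ) (hμpos : ∀ ω, 0 < μ ω)
    (P : Ω → SP → ℝ) (hP : IsExperiment P)
    (Q : Ω → SQ → ℝ) (hQ : IsExperiment Q)
    (hBlackwell : ∀ φ : (Ω → ℝ) → ℝ, ConvexOn ℝ (stdSimplex ℝ Ω) φ →
      (∑ s, if 0 < ∑ ω, μ ω * Q ω s then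
          (∑ ω, μ ω * Q ω s) * φ (fun ω => μ ω * Q ω s / ∑ ω', μ ω' * Q ω' s)
        else 0)
      ≤ ∑ s, if 0 < ∑ ω, μ ω * P ω s then
          (∑ ω, μ ω * P ω s) * φ (fun ω => μ ω * P ω s / ∑ ω', μ ω' * P ω' s)
        else 0) :
    alphaMI α Q μ ≤ alphaMI α P μ := by
  have hc : ∀ ω, 0 ≤ μ ω ^ (1 / α) / μ ω := fun ω =>
    div_nonneg (rpow_nonneg (hμpos ω).le _) (hμpos ω).le
  have hPs := fun s => posterior_Lp_eq hα0 hμpos fun ω => hP.1 ω s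
  have hQs := fun s => posterior_Lp_eq hα0 hμpos fun ω => hQ.1 ω s
  unfold alphaMI
  have hneg : ∀ (p : Prop) [Decidable p] (a : ℝ), (if p then -a else 0) = -(if p then a else 0) :=
    fun p _ a => by split_ifs <;> simp
  rcases lt_or_gt_of_ne hα1 with h1 | h1
  · have h := hBlackwell _ (concaveOn_weighted_Lp hα0 h1 hc).neg
    simp only [Pi.neg_apply, mul_neg, hneg, sum_neg_distrib, neg_le_neg_iff, hPs,
      hQs] at h
    exact mul_le_mul_of_nonpos_left (Real.log_le_log (alphaMI_arg_pos α hμ hμpos hP) h)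
      (div_nonpos_of_nonneg_of_nonpos hα0.le (by linarith))
  · have h := hBlackwell _ (convexOn_weighted_Lp h1.le hc)
    simp only [hPs, hQs] at h
    exact mul_le_mul_of_nonneg_left (Real.log_le_log (alphaMI_arg_pos α hμ hμpos hQ) h)
      (div_nonneg hα0.le (by linarith))
end

section
/- (Information monotonicity of α-mutual information.) Fix α ∈ (0,1)∪(1,∞), a prior μ with μ(ω) > 0 for all ω ∈ Ω, a statistical experiment P, and a partition {Ω_z}_{z∈Z} of Ω. Define the coarsened experiment P′ by setting, for ω ∈ Ω_z, P′(s|ω) := (Σ_{ω′∈Ω_z} P(s|ω′)·μ(ω′)) / (Σ_{ω′∈Ω_z} μ(ω′)). Then P′ is a statistical experiment and I_α(P,μ) ≥ I_α(P′,μ). -/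
open Real Finset

theorem IsExperiment.sum_rpow_pos {Ω S : Type*} [Fintype Ω] [Fintype S] [Nonempty Ω]
    {P : Ω → S → ℝ} (hP : IsExperiment P) {μ : Ω → ℝ} (hμ : ∀ ω, 0 < μ ω) (α : ℝ) :
    0 < ∑ s, (∑ ω, μ ω * P ω s ^ α) ^ (1 / α) := by
  have ω₀ : Ω := Classical.arbitrary Ω
  have nonneg_term (s : S) (ω : Ω) : 0 ≤ μ ω * P ω s ^ α :=
    mul_nonneg (hμ ω).le (rpow_nonneg (hP.1 ω s) α)
  obtain ⟨s₀, -, hs₀⟩ : ∃ s ∈ (Finset.univ : Finset S), 0 < P ω₀ s :=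
    Finset.exists_lt_of_sum_lt (f := fun _ => (0 : ℝ)) (by simp [hP.2 ω₀])
  refine Finset.sum_pos' (fun s _ => rpow_nonneg (Finset.sum_nonneg fun ω _ => nonneg_term s ω) _)
    ⟨s₀, Finset.mem_univ _, rpow_pos_of_pos ?_ _⟩
  exact Finset.sum_pos' (fun ω _ => nonneg_term s₀ ω)
    ⟨ω₀, Finset.mem_univ _, mul_pos (hμ ω₀) (rpow_pos_of_pos hs₀ α)⟩

/-- Jensen's inequality for averaging over the fibres of a map. -/
theorem ConvexOn.sum_fiber_average_le {Ω Z : Type*} [Fintype Ω] [Fintype Z] [DecidableEq Z]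
    {t : Set ℝ} {f : ℝ → ℝ} (hf : ConvexOn ℝ t f) {μ : Ω → ℝ} (hμ : ∀ ω, 0 < μ ω)
    (part : Ω → Z) {p p' : Ω → ℝ} (hp : ∀ ω, p ω ∈ t)
    (hp' : ∀ ω, p' ω = (∑ ω' with part ω' = part ω, p ω' * μ ω') /
      ∑ ω' with part ω' = part ω, μ ω') :
    ∑ ω, μ ω * f (p' ω) ≤ ∑ ω, μ ω * f (p ω) := by
  rw [← Finset.sum_fiberwise Finset.univ part, ← Finset.sum_fiberwise Finset.univ part]
  refine Finset.sum_le_sum fun z _ => ?_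
  set F : Finset Ω := {ω | part ω = z} with hF
  rcases F.eq_empty_or_nonempty with h | h
  · simp [h]
  have hM : 0 < ∑ ω ∈ F, μ ω := Finset.sum_pos (fun ω _ => hμ ω) h
  have average_eq : ∀ ω ∈ F, μ ω * f (p' ω) = μ ω * f (F.centerMass μ p) := by
    intro ω hω
    obtain rfl : part ω = z := by simpa [hF] using hω
    rw [hp' ω, Finset.centerMass, smul_eq_mul, div_eq_inv_mul]
    simp only [smul_eq_mul, mul_comm, hF]
  have jensen := hf.map_centerMass_le (fun ω _ => (hμ ω).le) hM (fun ω _ => hp ω)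
  rw [Finset.sum_congr rfl average_eq, ← Finset.sum_mul]
  refine (mul_le_mul_of_nonneg_left jensen hM.le).trans_eq ?_
  simp only [Finset.centerMass, smul_eq_mul, Function.comp_apply]
  rw [mul_inv_cancel_left₀ hM.ne']

theorem IsExperiment.fiber_average {Ω S Z : Type*} [Fintype Ω] [Fintype S] [DecidableEq Z]
    {μ : Ω → ℝ} (hμ : ∀ ω, 0 < μ ω) {P P' : Ω → S → ℝ} (hP : IsExperiment P) (part : Ω → Z)
    (hP' : ∀ ω s, P' ω s = (∑ ω' with part ω' = part ω, P ω' s * μ ω') /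
      ∑ ω' with part ω' = part ω, μ ω') :
    IsExperiment P' := by
  refine ⟨fun ω s => ?_, fun ω => ?_⟩
  · rw [hP']
    exact div_nonneg (Finset.sum_nonneg fun i _ => mul_nonneg (hP.1 i s) (hμ i).le)
      (Finset.sum_nonneg fun i _ => (hμ i).le)
  · have hM : 0 < ∑ ω' with part ω' = part ω, μ ω' :=
      Finset.sum_pos (fun i _ => hμ i) ⟨ω, by simp⟩
    simp_rw [hP', ← Finset.sum_div]
    rw [Finset.sum_comm]
    simp_rw [← Finset.sum_mul, hP.2, one_mul]
    exact div_self hM.ne'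

theorem alphaMI_information_monotone
    {Ω S Z : Type*} [Fintype Ω] [Fintype S] [Fintype Z] [DecidableEq Z]
    (α : ℝ) (hα0 : 0 < α) (hα1 : α ≠ 1)
    (μ : Ω → ℝ) (hμ : IsPrior μ) (hμpos : ∀ ω, 0 < μ ω)
    (P : Ω → S → ℝ) (hP : IsExperiment P)
    (part : Ω → Z)
    (P' : Ω → S → ℝ)
    (hP' : ∀ ω s, P' ω s =
      (∑ ω' ∈ Finset.univ.filter (fun ω' => part ω' = part ω), P ω' s * μ ω') /
      (∑ ω' ∈ Finset.univ.filter (fun ω' => part ω' = part ω), μ ω')) :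
    IsExperiment P' ∧ alphaMI α P' μ ≤ alphaMI α P μ := by
  have hPE' : IsExperiment P' := hP.fiber_average hμpos part hP'
  refine ⟨hPE', ?_⟩
  have : Nonempty Ω := by
    by_contra h
    rw [not_nonempty_iff] at h
    simpa using hμ.2
  have sum_nonneg {Q : Ω → S → ℝ} (hQ : IsExperiment Q) (s : S) :
      0 ≤ ∑ ω, μ ω * Q ω s ^ α :=
    Finset.sum_nonneg fun ω _ => mul_nonneg (hμpos ω).le (rpow_nonneg (hQ.1 ω s) α)
  have hα_inv : 0 ≤ 1 / α := by positivity
  unfold alphaMI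
  rcases hα1.lt_or_gt with hα | hα
  · refine mul_le_mul_of_nonpos_left (Real.log_le_log (hP.sum_rpow_pos hμpos α) ?_)
      (div_nonpos_of_nonneg_of_nonpos hα0.le (by linarith))
    refine Finset.sum_le_sum fun s _ => rpow_le_rpow (sum_nonneg hP s) ?_ hα_inv
    have jensen := (Real.concaveOn_rpow hα0.le hα.le).neg.sum_fiber_average_le hμpos part
      (fun ω => hP.1 ω s) (fun ω => hP' ω s)
    simpa using jensen
  · refine mul_le_mul_of_nonneg_left (Real.log_le_log (hPE'.sum_rpow_pos hμpos α) ?_)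
      (div_nonneg hα0.le (by linarith))
    exact Finset.sum_le_sum fun s _ => rpow_le_rpow (sum_nonneg hPE' s)
      ((convexOn_rpow hα.le).sum_fiber_average_le hμpos part
        (fun ω => hP.1 ω s) (fun ω => hP' ω s)) hα_inv
end

section
/- (Prior invariance of α-mutual information.) Fix α ∈ (0,1)∪(1,∞), a statistical experiment P, a partition {Ω_z}_{z∈Z} of Ω, and two priors μ, μ̄ with μ(ω) > 0 and μ̄(ω) > 0 for all ω ∈ Ω, such that Σ_{ω∈Ω_z} μ(ω) = Σ_{ω∈Ω_z} μ̄(ω) for every z ∈ Z. Define P′ by P′(s|ω) := (Σ_{ω′∈Ω_z} P(s|ω′)μ(ω′)) / (Σ_{ω′∈Ω_z} μ(er′)) for ω ∈ Ω_z, and define P̄ by P̄(s|ω) := (Σ_{ω′∈Ω_z} P(s|ω′)μ(ω′)) / (Σ_{ω′∈Ω_z} μ̄(ω′)) for ω ∈ Ω_z. Then P̄ is a statistical experiment and I_α(P′,μ) = I_α(P̄,μ̄). -/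
open Real Finset

/-- Priors with equal mass on every fibre of `part` weigh functions constant on fibres equally. -/
theorem sum_mul_comp_eq_of_fiber_sum_eq {Ω Z : Type*} [Fintype Ω] [Fintype Z] [DecidableEq Z]
    (part : Ω → Z) {μ ν : Ω → ℝ}
    (h : ∀ z, ∑ ω with part ω = z, μ ω = ∑ ω with part ω = z, ν ω) (f : Z → ℝ) :
    ∑ ω, μ ω * f (part ω) = ∑ ω, ν ω * f (part ω) := by
  have key : ∀ w : Ω → ℝ,
      ∑ ω, w ω * f (part ω) = ∑ z, (∑ ω with part ω = z, w ω) * f z := by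
    intro w
    rw [← Finset.sum_fiberwise Finset.univ part]
    refine Finset.sum_congr rfl fun z _ => ?_
    rw [Finset.sum_mul]
    refine Finset.sum_congr rfl fun ω hω => ?_
    rw [(Finset.mem_filter.mp hω).2]
  simp only [key, h]

theorem alphaMI_prior_invariance
    {Ω S Z : Type*} [Fintype Ω] [Fintype S] [Fintype Z] [DecidableEq Z]
    (α : ℝ) (hα0 : 0 < α) (hα1 : α ≠ 1)
    (P : Ω → S → ℝ) (hP : IsExperiment P)
    (part : Ω → Z)
    (μ μbar : Ω → ℝ) (hμ : IsPrior μ) (hμbar : IsPrior μbar)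
    (hμpos : ∀ ω, 0 < μ ω) (hμbarpos : ∀ ω, 0 < μbar ω)
    (hEq : ∀ z : Z,
      (∑ ω ∈ Finset.univ.filter (fun ω => part ω = z), μ ω) =
      (∑ ω ∈ Finset.univ.filter (fun ω => part ω = z), μbar ω))
    (P' : Ω → S → ℝ)
    (hP' : ∀ ω s, P' ω s =
      (∑ ω' ∈ Finset.univ.filter (fun ω' => part ω' = part ω), P ω' s * μ ω') /
      (∑ ω' ∈ Finset.univ.filter (fun ω' => part ω' = part ω), μ ω'))
    (Pbar : Ω → S → ℝ)
    (hPbar : ∀ ω s, Pbar ω s =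
      (∑ ω' ∈ Finset.univ.filter (fun ω' => part ω' = part ω), P ω' s * μ ω') /
      (∑ ω' ∈ Finset.univ.filter (fun ω' => part ω' = part ω), μbar ω')) :
    IsExperiment Pbar ∧ alphaMI α P' μ = alphaMI α Pbar μbar := by
  refine ⟨⟨fun ω s => ?_, fun ω => ?_⟩, ?_⟩
  · rw [hPbar]
    exact div_nonneg (Finset.sum_nonneg fun ω' _ => mul_nonneg (hP.1 ω' s) (hμ.1 ω'))
      (Finset.sum_nonneg fun ω' _ => hμbar.1 ω')
  · have hpos : 0 < ∑ ω' ∈ Finset.univ.filter (fun ω' => part ω' = part ω), μ ω' :=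
      Finset.sum_pos (fun ω' _ => hμpos ω') ⟨ω, by simp⟩
    simp only [hPbar, ← hEq]
    rw [← Finset.sum_div, Finset.sum_comm]
    simp only [← Finset.sum_mul, hP.2, one_mul]
    exact div_self hpos.ne'
  · have hP'_eq : P' = Pbar := by
      funext ω s
      rw [hP', hPbar, hEq]
    have hsum : ∀ s, ∑ ω, μ ω * Pbar ω s ^ α = ∑ ω, μbar ω * Pbar ω s ^ α := by
      intro s
      simp only [hPbar]
      exact sum_mul_comp_eq_of_fiber_sum_eq part hEq fun z =>
        ((∑ ω' ∈ Finset.univ.filter (fun ω' => part ω' = z), P ω' s * μ ω') /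
          (∑ ω' ∈ Finset.univ.filter (fun ω' => part ω' = z), μbar ω')) ^ α
    simp only [hP'_eq, alphaMI, hsum]
end

section
/- (Invariant likelihood ratio property of the Shannon model.) Let P* be a Shannon-RI optimum. Then for every state ω with μ(ω) > 0 and all actions a, b with P*(a|ω) > 0 and P*(b|ω) > 0, the posterior odds satisfy (P*(a|ω)/μP*_S(a)) · (μP*_S(b)/P*(b|ω)) = exp((u(a,ω) − u(b,ω))/κ). -/
open Real Finset

/-- Shannon mutual information (terms with `P ω s = 0` vanish since `0 * log _ = 0`). -/
noncomputable def shannonMI {Ω S : Type*} [Fintype Ω] [Fintype S]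
    (P : Ω → S → ℝ) (μ : Ω → ℝ) : ℝ :=
  ∑ ω, ∑ s, μ ω * P ω s * Real.log (P ω s / ∑ ω', μ ω' * P ω' s)

/-- A Shannon-RI optimum: an experiment maximizing expected utility net of
mutual-information costs. -/
def IsShannonRIOptimum {Ω S : Type*} [Fintype Ω] [Fintype S]
    (u : S → Ω → ℝ) (κ : ℝ) (μ : Ω → ℝ) (Pstar : Ω → S → ℝ) : Prop :=
  IsExperiment Pstar ∧ ∀ P : Ω → S → ℝ, IsExperiment P →
    (∑ ω, ∑ s, μ ω * P ω s * u s ω) - κ * shannonMI P μ ≤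
    (∑ ω, ∑ s, μ ω * Pstar ω s * u s ω) - κ * shannonMI Pstar μ

open Topology in
/-- Moving an experiment slightly along a direction that preserves row sums and is supported where
the experiment is positive yields experiments. -/
theorem IsExperiment.eventually_add_mul {Ω S : Type*} [Fintype Ω] [Fintype S]
    {P D : Ω → S → ℝ} (hP : IsExperiment P) (hD : ∀ ω, ∑ s, D ω s = 0)
    (hpos : ∀ ω s, D ω s ≠ 0 → 0 < P ω s) :
    ∀ᶠ t : ℝ in 𝓝 0, IsExperiment fun ω s => P ω s + t * D ω s := by
  have hnonneg : ∀ᶠ t : ℝ in 𝓝 0, ∀ ω s, 0 ≤ P ω s + t * D ω s := by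
    refine Filter.eventually_all.2 fun ω => Filter.eventually_all.2 fun s => ?_
    by_cases h : D ω s = 0
    · simp [h, hP.1 ω s]
    · have hc : ContinuousAt (fun t : ℝ => P ω s + t * D ω s) 0 := by fun_prop
      have := hc.eventually (lt_mem_nhds (by simpa using hpos ω s h))
      exact this.mono fun t ht => ht.le
  filter_upwards [hnonneg] with t ht
  refine ⟨ht, fun ω => ?_⟩
  rw [Finset.sum_add_distrib, ← Finset.mul_sum, hD, hP.2]
  ring

theorem hasDerivAt_affine_mul_log_div {p q d e : ℝ} (hp : p ≠ 0) (hq : q ≠ 0) :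
    HasDerivAt (fun t : ℝ => (p + t * d) * Real.log ((p + t * d) / (q + t * e)))
      (d * Real.log (p / q) + d - p * (e / q)) 0 := by
  have hN : HasDerivAt (fun t : ℝ => p + t * d) d 0 := by
    simpa using ((hasDerivAt_id (0 : ℝ)).mul_const d).const_add p
  have hM : HasDerivAt (fun t : ℝ => q + t * e) e 0 := by
    simpa using ((hasDerivAt_id (0 : ℝ)).mul_const e).const_add q
  have hlog := (hN.fun_div hM (by simpa using hq)).log (by simp [hp, hq])
  refine (hN.fun_mul hlog).congr_deriv ?_
  simp only [zero_mul, add_zero]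
  field_simp
  ring

/-- The directional derivative of mutual information. -/
theorem hasDerivAt_shannonMI {Ω S : Type*} [Fintype Ω] [Fintype S]
    {μ : Ω → ℝ} (hμ : ∀ ω, 0 ≤ μ ω) {P D : Ω → S → ℝ} (hP : IsExperiment P)
    (hpos : ∀ ω s, D ω s ≠ 0 → 0 < P ω s) :
    HasDerivAt (fun t : ℝ => shannonMI (fun ω s => P ω s + t * D ω s) μ)
      (∑ ω, ∑ s, μ ω * D ω s * Real.log (P ω s / ∑ ω', μ ω' * P ω' s)) 0 := by
  set q : S → ℝ := fun s => ∑ ω, μ ω * P ω s with hq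
  set e : S → ℝ := fun s => ∑ ω, μ ω * D ω s with he
  have hq_pos : ∀ ω s, 0 < μ ω → 0 < P ω s → 0 < q s := fun ω s hω hs =>
    Finset.sum_pos' (fun ω' _ => mul_nonneg (hμ ω') (hP.1 ω' s))
      ⟨ω, Finset.mem_univ ω, mul_pos hω hs⟩
  have hmarg : ∀ t s, ∑ ω, μ ω * (P ω s + t * D ω s) = q s + t * e s := fun t s => by
    simp only [hq, he, Finset.mul_sum, ← Finset.sum_add_distrib]
    exact Finset.sum_congr rfl fun ω _ => by ring
  have hterm : ∀ ω s, HasDerivAt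
      (fun t : ℝ => μ ω * (P ω s + t * D ω s) *
        Real.log ((P ω s + t * D ω s) / (q s + t * e s)))
      (μ ω * (D ω s * Real.log (P ω s / q s) + D ω s - P ω s * (e s / q s))) 0 := by
    intro ω s
    rcases (hμ ω).eq_or_lt with hω | hω
    · simpa [← hω] using hasDerivAt_const (0 : ℝ) (0 : ℝ)
    rcases (hP.1 ω s).eq_or_lt with hs | hs
    · have hd : D ω s = 0 := by
        by_contra h
        exact (hpos ω s h).ne hs
      simpa [← hs, hd] using hasDerivAt_const (0 : ℝ) (0 : ℝ)
    · simp only [mul_assoc (μ ω)]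
      exact (hasDerivAt_affine_mul_log_div hs.ne' (hq_pos ω s hω hs).ne').const_mul (μ ω)
  have hcancel : ∀ s, q s * (e s / q s) = e s := by
    intro s
    by_cases h : q s = 0
    · have : e s = 0 := Finset.sum_eq_zero fun ω _ => by
        rcases (hμ ω).eq_or_lt with hω | hω
        · simp [← hω]
        · by_contra hne
          exact (hq_pos ω s hω (hpos ω s (right_ne_zero_of_mul hne))).ne' h
      simp [this]
    · field_simp
  have hcorr : ∑ ω, ∑ s, μ ω * D ω s = ∑ ω, ∑ s, μ ω * P ω s * (e s / q s) := by
    rw [Finset.sum_comm, Finset.sum_comm (f := fun ω s => μ ω * P ω s * (e s / q s))]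
    refine Finset.sum_congr rfl fun s _ => ?_
    rw [← Finset.sum_mul]
    exact (hcancel s).symm
  simp only [shannonMI, hmarg]
  refine (HasDerivAt.fun_sum fun ω _ => HasDerivAt.fun_sum fun s _ => hterm ω s).congr_deriv ?_
  simp only [mul_sub, mul_add, Finset.sum_sub_distrib, Finset.sum_add_distrib, ← mul_assoc]
  linarith

/-- The first-order condition at a Shannon-RI optimum. -/
theorem IsShannonRIOptimum.first_order {Ω S : Type*} [Fintype Ω] [Fintype S]
    {u : S → Ω → ℝ} {κ : ℝ} {μ : Ω → ℝ} {P D : Ω → S → ℝ}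
    (hopt : IsShannonRIOptimum u κ μ P) (hμ : ∀ ω, 0 ≤ μ ω)
    (hD : ∀ ω, ∑ s, D ω s = 0) (hpos : ∀ ω s, D ω s ≠ 0 → 0 < P ω s) :
    (∑ ω, ∑ s, μ ω * D ω s * u s ω) -
      κ * ∑ ω, ∑ s, μ ω * D ω s * Real.log (P ω s / ∑ ω', μ ω' * P ω' s) = 0 := by
  have hu : HasDerivAt (fun t : ℝ => ∑ ω, ∑ s, μ ω * (P ω s + t * D ω s) * u s ω)
      (∑ ω, ∑ s, μ ω * D ω s * u s ω) 0 := by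
    refine HasDerivAt.fun_sum fun ω _ => HasDerivAt.fun_sum fun s _ => ?_
    have h := ((hasDerivAt_id (0 : ℝ)).mul_const (D ω s)).const_add (P ω s)
    simpa using (h.const_mul (μ ω)).mul_const (u s ω)
  refine IsLocalMax.hasDerivAt_eq_zero ?_
    (hu.fun_sub ((hasDerivAt_shannonMI hμ hopt.1 hpos).const_mul κ))
  filter_upwards [hopt.1.eventually_add_mul hD hpos] with t ht
  simpa using hopt.2 _ ht

theorem shannon_invariant_likelihood_ratio
    {Ω S : Type*} [Fintype Ω] [Fintype S]
    (μ : Ω → ℝ) (hμ : IsPrior μ)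
    (u : S → Ω → ℝ) (κ : ℝ) (hκ : 0 < κ)
    (Pstar : Ω → S → ℝ) (hopt : IsShannonRIOptimum u κ μ Pstar) :
    ∀ ω : Ω, 0 < μ ω → ∀ a b : S, 0 < Pstar ω a → 0 < Pstar ω b →
      (Pstar ω a / ∑ ω', μ ω' * Pstar ω' a) *
        ((∑ ω', μ ω' * Pstar ω' b) / Pstar ω b)
      = Real.exp ((u a ω - u b ω) / κ) := by
  classical
  intro ω hω a b ha hb
  have hq_pos : ∀ s, 0 < Pstar ω s → 0 < ∑ ω', μ ω' * Pstar ω' s := fun s hs =>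
    Finset.sum_pos' (fun ω' _ => mul_nonneg (hμ.1 ω') (hopt.1.1 ω' s))
      ⟨ω, Finset.mem_univ ω, mul_pos hω hs⟩
  have hqa := hq_pos a ha
  have hqb := hq_pos b hb
  let δ : S → ℝ := Pi.single a 1 - Pi.single b 1
  have hδ : ∀ f : S → ℝ, ∑ s, δ s * f s = f a - f b := fun f => by
    simp [δ, sub_mul, Finset.sum_sub_distrib, Pi.single_apply]
  let D : Ω → S → ℝ := fun ω' s => if ω' = ω then δ s else 0
  have hDsum : ∀ f : Ω → S → ℝ, ∑ ω', ∑ s, μ ω' * D ω' s * f ω' s = μ ω * (f ω a - f ω b) := by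
    intro f
    rw [Finset.sum_eq_single ω (fun ω' _ hne => by simp [D, hne]) (by simp), ← hδ, Finset.mul_sum]
    simp [D, mul_assoc]
  have hfoc := hopt.first_order (D := D) hμ.1
    (fun ω' => by
      by_cases h : ω' = ω
      · simpa [D, h] using hδ fun _ => 1
      · simp [D, h])
    (fun ω' s hne => by
      obtain rfl : ω' = ω := by
        by_contra h
        simp [D, h] at hne
      by_cases hsa : s = a
      · exact hsa ▸ ha
      by_cases hsb : s = b
      · exact hsb ▸ hb
      simp [D, δ, hsa, hsb] at hne)
  rw [hDsum fun ω' s => u s ω',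
    hDsum fun ω' s => Real.log (Pstar ω' s / ∑ ω'', μ ω'' * Pstar ω'' s)] at hfoc
  have hlog : (u a ω - u b ω) / κ = Real.log (Pstar ω a / ∑ ω', μ ω' * Pstar ω' a) -
      Real.log (Pstar ω b / ∑ ω', μ ω' * Pstar ω' b) := by
    rw [div_eq_iff hκ.ne']
    apply mul_left_cancel₀ hω.ne'
    linarith
  rw [hlog, Real.exp_sub, Real.exp_log (div_pos ha hqa), Real.exp_log (div_pos hb hqb),
    div_eq_mul_inv _ (Pstar ω b / _), inv_div]
end

section
/- (Modified logit rule for the Shannon model.) Let P* be a Shannon-RI optimum. Then for every state ω with μ(ω) > 0 and every action a with P*(a|ω) > 0, one has P*(a|ω) = μP*_S(a)·exp(u(a,ω)/κ) / Σ_{b∈S} μP*_S(b)·exp(u(b,ω)/κ). -/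
open Real Finset

theorem sub_lt_mul_log_div {x y : ℝ} (hx : 0 ≤ x) (hy : 0 ≤ y) (hxy : y = 0 → x = 0)
    (hne : x ≠ y) : x - y < x * Real.log (x / y) := by
  rcases hx.eq_or_lt with rfl | hx
  · have : 0 < y := lt_of_le_of_ne hy hne
    simpa using this
  · have hy : 0 < y := lt_of_le_of_ne hy fun h => hx.ne' (hxy h.symm)
    have h := Real.log_lt_sub_one_of_pos (div_pos hy hx)
      (fun h => hne ((div_eq_one_iff_eq hx.ne').1 h).symm)
    have h' := mul_lt_mul_of_pos_left h hx
    rw [mul_sub, mul_div_cancel₀ _ hx.ne', ← inv_div, Real.log_inv] at h'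
    linarith

theorem sub_le_mul_log_div {x y : ℝ} (hx : 0 ≤ x) (hy : 0 ≤ y) (hxy : y = 0 → x = 0) :
    x - y ≤ x * Real.log (x / y) := by
  by_cases h : x = y
  · subst h
    by_cases h : x = 0 <;> simp [h]
  · exact (sub_lt_mul_log_div hx hy hxy h).le

/-- Gibbs' inequality. -/
theorem sum_mul_log_div_nonneg {S : Type*} [Fintype S] {p q : S → ℝ} (hp : ∀ s, 0 ≤ p s)
    (hq : ∀ s, 0 ≤ q s) (hpq : ∀ s, q s = 0 → p s = 0) (hsum : ∑ s, p s = ∑ s, q s) :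
    0 ≤ ∑ s, p s * Real.log (p s / q s) := by
  have h := Finset.sum_le_sum fun s (_ : s ∈ Finset.univ) =>
    sub_le_mul_log_div (hp s) (hq s) (hpq s)
  rw [Finset.sum_sub_distrib] at h
  linarith

/-- The equality case of Gibbs' inequality. -/
theorem eq_of_sum_mul_log_div_nonpos {S : Type*} [Fintype S] {p q : S → ℝ} (hp : ∀ s, 0 ≤ p s)
    (hq : ∀ s, 0 ≤ q s) (hpq : ∀ s, q s = 0 → p s = 0) (hsum : ∑ s, p s = ∑ s, q s)
    (hle : ∑ s, p s * Real.log (p s / q s) ≤ 0) : p = q := by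
  by_contra hne
  obtain ⟨a, ha⟩ := Function.ne_iff.1 hne
  have h := Finset.sum_lt_sum
    (fun s (_ : s ∈ Finset.univ) => sub_le_mul_log_div (hp s) (hq s) (hpq s))
    ⟨a, Finset.mem_univ a, sub_lt_mul_log_div (hp a) (hq a) (hpq a) ha⟩
  rw [Finset.sum_sub_distrib] at h
  linarith

theorem IsExperiment.sum_marginal {Ω S : Type*} [Fintype Ω] [Fintype S] {P : Ω → S → ℝ}
    {μ : Ω → ℝ} (hP : IsExperiment P) (hμ : IsPrior μ) : ∑ s, ∑ ω, μ ω * P ω s = 1 := by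
  rw [Finset.sum_comm]
  simp [← Finset.mul_sum, hP.2, hμ.2]

theorem IsExperiment.marginal_nonneg {Ω S : Type*} [Fintype Ω] [Fintype S] {P : Ω → S → ℝ}
    {μ : Ω → ℝ} (hP : IsExperiment P) (hμ : IsPrior μ) (s : S) : 0 ≤ ∑ ω, μ ω * P ω s :=
  Finset.sum_nonneg fun ω _ => mul_nonneg (hμ.1 ω) (hP.1 ω s)

theorem IsExperiment.mul_eq_zero_of_marginal_eq_zero {Ω S : Type*} [Fintype Ω] [Fintype S]
    {P : Ω → S → ℝ} {μ : Ω → ℝ} (hP : IsExperiment P) (hμ : IsPrior μ) {s : S}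
    (hs : ∑ ω, μ ω * P ω s = 0) (ω : Ω) : μ ω * P ω s = 0 :=
  (Finset.sum_eq_zero_iff_of_nonneg fun ω _ => mul_nonneg (hμ.1 ω) (hP.1 ω s)).1 hs ω
    (Finset.mem_univ ω)

/-- Mutual information is at most the average divergence from any reference distribution. -/
theorem shannonMI_le_sum_mul_log_div {Ω S : Type*} [Fintype Ω] [Fintype S] {P : Ω → S → ℝ}
    {μ : Ω → ℝ} (hP : IsExperiment P) (hμ : IsPrior μ) {r : S → ℝ} (hr : ∀ s, 0 ≤ r s)
    (hr1 : ∑ s, r s = 1) (hPr : ∀ ω s, r s = 0 → P ω s = 0) :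
    shannonMI P μ ≤ ∑ ω, ∑ s, μ ω * P ω s * Real.log (P ω s / r s) := by
  have hgibbs := sum_mul_log_div_nonneg (hP.marginal_nonneg hμ) hr
    (fun s hs => by simp [hPr _ s hs]) ((hP.sum_marginal hμ).trans hr1.symm)
  have hsplit : ∑ ω, ∑ s, μ ω * P ω s * Real.log (P ω s / r s) = shannonMI P μ +
      ∑ s, (∑ ω, μ ω * P ω s) * Real.log ((∑ ω, μ ω * P ω s) / r s) := by
    simp_rw [shannonMI, Finset.sum_mul _ _ (Real.log _)]
    rw [Finset.sum_comm (f := fun s ω => μ ω * P ω s * Real.log ((∑ ω', μ ω' * P ω' s) / r s)),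
      ← Finset.sum_add_distrib]
    refine Finset.sum_congr rfl fun ω _ => ?_
    rw [← Finset.sum_add_distrib]
    refine Finset.sum_congr rfl fun s _ => ?_
    by_cases h : μ ω * P ω s = 0
    · simp [h]
    · have hm : (∑ ω', μ ω' * P ω' s) ≠ 0 := fun h0 =>
        h (hP.mul_eq_zero_of_marginal_eq_zero hμ h0 ω)
      have hPs : P ω s ≠ 0 := right_ne_zero_of_mul h
      have hrs : r s ≠ 0 := fun h0 => hPs (hPr ω s h0)
      rw [Real.log_div hPs hrs, Real.log_div hPs hm, Real.log_div hm hrs]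
      ring
  linarith

theorem shannon_modified_logit_rule
    {Ω S : Type*} [Fintype Ω] [Fintype S]
    (μ : Ω → ℝ) (hμ : IsPrior μ)
    (u : S → Ω → ℝ) (κ : ℝ) (hκ : 0 < κ)
    (Pstar : Ω → S → ℝ) (hopt : IsShannonRIOptimum u κ μ Pstar) :
    ∀ ω : Ω, 0 < μ ω → ∀ a : S, 0 < Pstar ω a →
      Pstar ω a =
        (∑ ω', μ ω' * Pstar ω' a) * Real.exp (u a ω / κ) /
          ∑ b, (∑ ω', μ ω' * Pstar ω' b) * Real.exp (u b ω / κ) := by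
  obtain ⟨hP, hmax⟩ := hopt
  set q : S → ℝ := fun s => ∑ ω, μ ω * Pstar ω s with hq
  have hq0 : ∀ s, 0 ≤ q s := hP.marginal_nonneg hμ
  have hq1 : ∑ s, q s = 1 := hP.sum_marginal hμ
  have hterm : ∀ ω b, 0 ≤ q b * Real.exp (u b ω / κ) := fun ω b =>
    mul_nonneg (hq0 b) (Real.exp_pos _).le
  set Z : Ω → ℝ := fun ω => ∑ b, q b * Real.exp (u b ω / κ) with hZ
  have hZpos : ∀ ω, 0 < Z ω := by
    intro ω
    obtain ⟨b, hb⟩ : ∃ b, q b ≠ 0 := by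
      by_contra! h
      simp [h] at hq1
    exact Finset.sum_pos' (fun b _ => hterm ω b) ⟨b, Finset.mem_univ b,
      mul_pos (lt_of_le_of_ne (hq0 b) hb.symm) (Real.exp_pos _)⟩
  set L : Ω → S → ℝ := fun ω s => q s * Real.exp (u s ω / κ) / Z ω with hL
  have hLexp : IsExperiment L := by
    refine ⟨fun ω s => div_nonneg (hterm ω s) (hZpos ω).le, fun ω => ?_⟩
    simp only [hL]
    rw [← Finset.sum_div]
    exact div_self (hZpos ω).ne'
  have hLzero : ∀ ω s, L ω s = 0 → q s = 0 := by
    intro ω s h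
    simpa [hL, (hZpos ω).ne', Real.exp_ne_zero] using h
  have hlogL : ∀ ω s, q s ≠ 0 →
      Real.log (L ω s) = Real.log (q s) + u s ω / κ - Real.log (Z ω) := by
    intro ω s h
    simp only [hL]
    rw [Real.log_div (mul_ne_zero h (Real.exp_ne_zero _)) (hZpos ω).ne',
      Real.log_mul h (Real.exp_ne_zero _), Real.log_exp]
  -- Against the fixed reference `q`, each experiment falls short of the value of `L` by its
  -- divergence from `L`.
  have hvalue : ∀ P : Ω → S → ℝ, IsExperiment P → (∀ ω s, q s = 0 → μ ω * P ω s = 0) →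
      (∑ ω, ∑ s, μ ω * P ω s * u s ω) - κ * ∑ ω, ∑ s, μ ω * P ω s * Real.log (P ω s / q s) =
        κ * ∑ ω, μ ω * Real.log (Z ω)
          - κ * ∑ ω, μ ω * ∑ s, P ω s * Real.log (P ω s / L ω s) := by
    intro P hPexp hPq
    rw [← mul_sub, ← Finset.sum_sub_distrib, Finset.mul_sum, Finset.mul_sum,
      ← Finset.sum_sub_distrib]
    refine Finset.sum_congr rfl fun ω _ => ?_
    have hlog : μ ω * Real.log (Z ω) = ∑ s, μ ω * P ω s * Real.log (Z ω) := by
      rw [← Finset.sum_mul, ← Finset.mul_sum, hPexp.2, mul_one]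
    rw [hlog, Finset.mul_sum, Finset.mul_sum, ← Finset.sum_sub_distrib, ← Finset.sum_sub_distrib,
      Finset.mul_sum]
    refine Finset.sum_congr rfl fun s _ => ?_
    by_cases h : μ ω * P ω s = 0
    · simp [← mul_assoc, h]
    · have hqs : q s ≠ 0 := fun h0 => h (hPq ω s h0)
      have hPs : P ω s ≠ 0 := right_ne_zero_of_mul h
      rw [Real.log_div hPs hqs, Real.log_div hPs fun h0 => hqs (hLzero ω s h0), hlogL ω s hqs]
      field_simp
      ring
  have hLself : ∀ ω s, L ω s * Real.log (L ω s / L ω s) = 0 := by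
    intro ω s
    by_cases h : L ω s = 0 <;> simp [h]
  have hLq : ∀ ω s, q s = 0 → L ω s = 0 := fun ω s h => by simp [hL, h]
  have hvP := hvalue Pstar hP fun ω s hs => hP.mul_eq_zero_of_marginal_eq_zero hμ hs ω
  have hvL := hvalue L hLexp fun ω s hs => by rw [hLq ω s hs, mul_zero]
  simp only [hLself, Finset.sum_const_zero, mul_zero, sub_zero] at hvL
  have hMI := mul_le_mul_of_nonneg_left
    (shannonMI_le_sum_mul_log_div hLexp hμ hq0 hq1 hLq) hκ.le
  have hMIstar : shannonMI Pstar μ = ∑ ω, ∑ s, μ ω * Pstar ω s * Real.log (Pstar ω s / q s) := rfl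
  have hdiv : ∑ ω, μ ω * ∑ s, Pstar ω s * Real.log (Pstar ω s / L ω s) ≤ 0 := by
    have h := hmax L hLexp
    rw [hMIstar] at h
    exact nonpos_of_mul_nonpos_right (by linarith) hκ
  have hac : ∀ ω, 0 < μ ω → ∀ s, L ω s = 0 → Pstar ω s = 0 := fun ω hω s hs =>
    (mul_eq_zero.1 (hP.mul_eq_zero_of_marginal_eq_zero hμ (hLzero ω s hs) ω)).resolve_left hω.ne'
  have hdiv0 : ∀ ω, 0 ≤ μ ω * ∑ s, Pstar ω s * Real.log (Pstar ω s / L ω s) := by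
    intro ω
    rcases (hμ.1 ω).eq_or_lt with h | h
    · simp [← h]
    · exact mul_nonneg h.le (sum_mul_log_div_nonneg (hP.1 ω) (hLexp.1 ω) (hac ω h)
        ((hP.2 ω).trans (hLexp.2 ω).symm))
  intro ω hω a _
  have hle := (Finset.single_le_sum (fun ω _ => hdiv0 ω) (Finset.mem_univ ω)).trans hdiv
  exact congrFun (eq_of_sum_mul_log_div_nonpos (hP.1 ω) (hLexp.1 ω) (hac ω hω)
    ((hP.2 ω).trans (hLexp.2 ω).symm) (nonpos_of_mul_nonpos_right hle hω)) a
end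

section
/- (No learning with certainty for α < 1.) Fix α ∈ (0,1), a prior μ with μ(ω) > 0 for all ω ∈ Ω, a utility u : S × Ω → ℝ, and κ > 0. Let P* be an α-RI optimum. Then for every action a with μP*_S(a) > 0 and every state ω ∈ Ω one has P*(a|ω) > 0. In particular there is no non-trivial event E ⊊ Ω that the decision maker learns with certainty: no posterior induced by P* puts zero mass on any state. -/
open Real Finset

/-- An α-RI optimum: an experiment maximizing expected utility net of
α-mutual-information costs. -/
def IsAlphaRIOptimum {Ω S : Type*} [Fintype Ω] [Fintype S]
    (α : ℝ) (u : S → Ω → ℝ) (κ : ℝ) (μ : Ω → ℝ) (Pstar : Ω → S → ℝ) : Prop :=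
  IsExperiment Pstar ∧ ∀ P : Ω → S → ℝ, IsExperiment P →
    (∑ ω, ∑ s, μ ω * P ω s * u s ω) - κ * alphaMI α P μ ≤
    (∑ ω, ∑ s, μ ω * Pstar ω s * u s ω) - κ * alphaMI α Pstar μ

/-- Move mass `ε` from signal `b` to signal `a` in the row of state `ω₀`. -/
noncomputable def shiftMass {Ω S : Type*} (P : Ω → S → ℝ) (ω₀ : Ω) (a b : S) (ε : ℝ) :
    Ω → S → ℝ :=
  open Classical in
  fun ω s => P ω s + if ω = ω₀ then ((if s = a then ε else 0) - if s = b then ε else 0) else 0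

section ShiftMass

variable {Ω S : Type*} (P : Ω → S → ℝ) {ω₀ : Ω} {a b : S} {ε : ℝ}

lemma shiftMass_of_ne_state {ω : Ω} (h : ω ≠ ω₀) (s : S) :
    shiftMass P ω₀ a b ε ω s = P ω s := by
  simp [shiftMass, h]

lemma shiftMass_of_ne_signals (ω : Ω) {s : S} (ha : s ≠ a) (hb : s ≠ b) :
    shiftMass P ω₀ a b ε ω s = P ω s := by
  simp [shiftMass, ha, hb]

lemma shiftMass_target (hab : a ≠ b) :
    shiftMass P ω₀ a b ε ω₀ a = P ω₀ a + ε := by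
  simp [shiftMass, hab]

lemma shiftMass_source (hab : a ≠ b) :
    shiftMass P ω₀ a b ε ω₀ b = P ω₀ b - ε := by
  simp [shiftMass, hab.symm, sub_eq_add_neg]

variable [Fintype Ω] [Fintype S]

lemma isExperiment_shiftMass {P : Ω → S → ℝ} (hP : IsExperiment P) (hab : a ≠ b) (hε : 0 ≤ ε)
    (hεb : ε ≤ P ω₀ b) : IsExperiment (shiftMass P ω₀ a b ε) := by
  refine ⟨fun ω s => ?_, fun ω => ?_⟩
  · by_cases hω : ω = ω₀
    · subst hω
      by_cases ha : s = a
      · subst ha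
        rw [shiftMass_target P hab]
        exact add_nonneg (hP.1 _ _) hε
      · by_cases hb : s = b
        · subst hb
          rw [shiftMass_source P hab]
          linarith
        · rw [shiftMass_of_ne_signals P ω ha hb]
          exact hP.1 _ _
    · rw [shiftMass_of_ne_state P hω]
      exact hP.1 _ _
  · classical
    by_cases hω : ω = ω₀
    · simp only [shiftMass, hω, if_true, Finset.sum_add_distrib, hP.2, Finset.sum_sub_distrib,
        Finset.sum_ite_eq', Finset.mem_univ, sub_self, add_zero]
    · simp [shiftMass, hω, hP.2]

lemma expectedUtility_shiftMass (μ : Ω → ℝ) (u : S → Ω → ℝ) :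
    ∑ ω, ∑ s, μ ω * shiftMass P ω₀ a b ε ω s * u s ω =
      ∑ ω, ∑ s, μ ω * P ω s * u s ω + μ ω₀ * ε * (u a ω₀ - u b ω₀) := by
  classical
  have row (ω : Ω) : ∑ s, μ ω * shiftMass P ω₀ a b ε ω s * u s ω =
      ∑ s, μ ω * P ω s * u s ω +
        if ω = ω₀ then μ ω₀ * ε * (u a ω₀ - u b ω₀) else 0 := by
    by_cases hω : ω = ω₀
    · subst hω
      simp only [shiftMass, if_true, mul_add, add_mul, mul_sub, sub_mul, Finset.sum_add_distrib,
        Finset.sum_sub_distrib, mul_ite, ite_mul, mul_zero, zero_mul, Finset.sum_ite_eq',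
        Finset.mem_univ]
    · simp [shiftMass, hω]
  simp_rw [row, Finset.sum_add_distrib]
  simp

end ShiftMass

lemma rpow_add_le_add_rpow_of_one_le {A x q : ℝ} (hA : 0 < A) (hx : 0 ≤ x) (hq : 1 ≤ q) :
    A ^ q + A ^ q * (x / A) ≤ (A + x) ^ q := by
  have hxA : 0 ≤ x / A := by positivity
  have h : 1 + q * (x / A) ≤ (1 + x / A) ^ q :=
    one_add_mul_self_le_rpow_one_add (by linarith) hq
  have e : A + x = A * (1 + x / A) := by field_simp
  rw [e, mul_rpow hA.le (by linarith)]
  have : 1 + x / A ≤ (1 + x / A) ^ q := by nlinarith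
  nlinarith [mul_le_mul_of_nonneg_left this (rpow_nonneg hA.le q)]

/-- Shifting the fraction `δ` of the mass of `b` to a signal `a` that has probability zero raises
the `α`-norm sum by a term of order `δ ^ α`, up to a linear loss. -/
lemma le_sum_rpow_shiftMass {Ω S : Type*} [Fintype Ω] [Fintype S] {α : ℝ} (hα0 : 0 < α)
    (hα1 : α < 1) {μ : Ω → ℝ} (hμ : ∀ ω, 0 ≤ μ ω) {P : Ω → S → ℝ} (hP : IsExperiment P)
    {ω₀ : Ω} {a b : S} (hab : a ≠ b) (ha : P ω₀ a = 0) (hA : 0 < ∑ ω, μ ω * P ω a ^ α)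
    {δ : ℝ} (hδ0 : 0 ≤ δ) (hδ1 : δ ≤ 1) :
    ∑ s, (∑ ω, μ ω * P ω s ^ α) ^ (1 / α) +
        (∑ ω, μ ω * P ω a ^ α) ^ (1 / α) * (μ ω₀ * P ω₀ b ^ α / ∑ ω, μ ω * P ω a ^ α) * δ ^ α -
        (∑ ω, μ ω * P ω b ^ α) ^ (1 / α) * δ ≤
      ∑ s, (∑ ω, μ ω * shiftMass P ω₀ a b (P ω₀ b * δ) ω s ^ α) ^ (1 / α) := by
  classical
  set K := (∑ ω, μ ω * P ω a ^ α) ^ (1 / α) * (μ ω₀ * P ω₀ b ^ α / ∑ ω, μ ω * P ω a ^ α) with hK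
  set L := (∑ ω, μ ω * P ω b ^ α) ^ (1 / α) with hL
  have hp := hP.1 ω₀ b
  have e : ∑ s, (∑ ω, μ ω * P ω s ^ α) ^ (1 / α) + K * δ ^ α - L * δ =
      ∑ s, ((∑ ω, μ ω * P ω s ^ α) ^ (1 / α) + (if s = a then K * δ ^ α else 0) -
        (if s = b then L * δ else 0)) := by
    simp [Finset.sum_add_distrib]
  rw [e]
  refine Finset.sum_le_sum fun s _ => ?_
  by_cases hsa : s = a
  · subst hsa
    have h1 : ∑ ω, μ ω * shiftMass P ω₀ s b (P ω₀ b * δ) ω s ^ α =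
        ∑ ω, μ ω * P ω s ^ α + μ ω₀ * (P ω₀ b * δ) ^ α := by
      have : ∀ ω, μ ω * shiftMass P ω₀ s b (P ω₀ b * δ) ω s ^ α =
          μ ω * P ω s ^ α + if ω = ω₀ then μ ω₀ * (P ω₀ b * δ) ^ α else 0 := by
        intro ω
        by_cases hω : ω = ω₀
        · subst hω
          simp [shiftMass_target P hab, ha, zero_rpow hα0.ne']
        · simp [shiftMass_of_ne_state P hω, hω]
      simp_rw [this, Finset.sum_add_distrib]
      simp
    rw [h1]
    have hx : 0 ≤ μ ω₀ * (P ω₀ b * δ) ^ α :=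
      mul_nonneg (hμ _) (rpow_nonneg (mul_nonneg hp hδ0) _)
    have h2 := rpow_add_le_add_rpow_of_one_le hA hx (one_le_one_div hα0 hα1.le)
    have h3 : K * δ ^ α = (∑ ω, μ ω * P ω s ^ α) ^ (1 / α) *
        (μ ω₀ * (P ω₀ b * δ) ^ α / ∑ ω, μ ω * P ω s ^ α) := by
      rw [hK, mul_rpow hp hδ0]
      ring
    simp only [if_true, if_neg hab, sub_zero, h3]
    exact h2
  · by_cases hsb : s = b
    · subst hsb
      have hd : 0 ≤ 1 - δ := by linarith
      have hB : 0 ≤ ∑ ω, μ ω * P ω s ^ α :=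
        Finset.sum_nonneg fun ω _ => mul_nonneg (hμ _) (rpow_nonneg (hP.1 _ _) _)
      have h1 : (1 - δ) ^ α * ∑ ω, μ ω * P ω s ^ α ≤
          ∑ ω, μ ω * shiftMass P ω₀ a s (P ω₀ s * δ) ω s ^ α := by
        rw [Finset.mul_sum]
        refine Finset.sum_le_sum fun ω _ => ?_
        have h : (1 - δ) * P ω s ≤ shiftMass P ω₀ a s (P ω₀ s * δ) ω s := by
          by_cases hω : ω = ω₀
          · subst hω
            rw [shiftMass_source P hab]
            linarith
          · rw [shiftMass_of_ne_state P hω]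
            nlinarith [hP.1 ω s]
        have h' := rpow_le_rpow (mul_nonneg hd (hP.1 ω s)) h hα0.le
        rw [mul_rpow hd (hP.1 ω s)] at h'
        nlinarith [mul_le_mul_of_nonneg_left h' (hμ ω)]
      have h2 := rpow_le_rpow (mul_nonneg (rpow_nonneg hd _) hB) h1
        (one_div_pos.2 hα0).le
      rw [mul_rpow (rpow_nonneg hd _) hB, ← rpow_mul hd, mul_one_div_cancel hα0.ne',
        rpow_one] at h2
      simp only [if_neg hsa, if_true]
      linarith
    · simp [hsa, hsb, shiftMass_of_ne_signals P _ hsa hsb]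

/-- A gain of order `δ ^ α` inside a logarithm beats any linear loss for small `δ`. -/
lemma exists_linear_loss_lt_log_gain {α : ℝ} (hα0 : 0 < α) (hα1 : α < 1) {c G K : ℝ} (hc : 0 < c)
    (hG : 0 < G) (hK : 0 < K) {L : ℝ} (hL : 0 ≤ L) (M : ℝ) :
    ∃ δ : ℝ, 0 < δ ∧ δ ≤ 1 ∧ 0 < G + K * δ ^ α - L * δ ∧
      M * δ < c * (log (G + K * δ ^ α - L * δ) - log G) := by
  obtain ⟨T, hT1, hTL, hTM⟩ :
      ∃ T : ℝ, 1 ≤ T ∧ 0 < K * T - L ∧ |M| * (G + K) < c * (K * T - L) := by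
    have e : K * (1 + (L + |M| * (G + K) / c) / K) - L = K + |M| * (G + K) / c := by
      field_simp
      ring
    have hM : 0 ≤ |M| * (G + K) / c := by positivity
    refine ⟨1 + (L + |M| * (G + K) / c) / K, ?_, ?_, ?_⟩
    · linarith [div_nonneg (add_nonneg hL hM) hK.le]
    · rw [e]
      linarith
    · rw [e, mul_add c, mul_div_cancel₀ _ hc.ne']
      linarith [mul_pos hc hK]
  have hT0 : 0 < T := by linarith
  set δ := T ^ (1 / (α - 1)) with hδ
  have hδ0 : 0 < δ := rpow_pos_of_pos hT0 _
  have hδ1 : δ ≤ 1 :=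
    rpow_le_one_of_one_le_of_nonpos hT1 (one_div_nonpos.2 (by linarith))
  have hδα : δ ^ α = T * δ := by
    have h : δ ^ (α - 1) = T := by
      rw [hδ, ← rpow_mul hT0.le, one_div_mul_cancel (by linarith), rpow_one]
    rw [rpow_sub_one hδ0.ne', div_eq_iff hδ0.ne'] at h
    exact h
  have hδα1 : δ ^ α ≤ 1 := rpow_le_one hδ0.le hδ1 hα0.le
  set h := K * δ ^ α - L * δ with hh
  have e : G + K * δ ^ α - L * δ = G + h := by ring
  have h_eq : h = δ * (K * T - L) := by
    rw [hh, hδα]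
    ring
  have h_pos : 0 < h := h_eq ▸ mul_pos hδ0 hTL
  have h_le : h ≤ K := by nlinarith
  refine ⟨δ, hδ0, hδ1, by rw [e]; linarith, ?_⟩
  have hlog : h / (G + K) ≤ log (G + h) - log G := by
    have h1 := one_sub_inv_le_log_of_pos (x := (G + h) / G) (by positivity)
    rw [log_div (by positivity) hG.ne'] at h1
    have h2 : 1 - ((G + h) / G)⁻¹ = h / (G + h) := by
      field_simp
      ring
    have h3 : h / (G + K) ≤ h / (G + h) := by gcongr
    linarith
  rw [e]
  calc M * δ ≤ |M| * δ := by gcongr; exact le_abs_self M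
    _ < c * (h / (G + K)) := by
      rw [← mul_div_assoc, lt_div_iff₀ (by positivity), h_eq]
      nlinarith [mul_lt_mul_of_pos_left hTM hδ0]
    _ ≤ c * (log (G + h) - log G) := by gcongr

theorem no_learning_with_certainty_of_alpha_lt_one
    {Ω S : Type*} [Fintype Ω] [Fintype S]
    (α : ℝ) (hα0 : 0 < α) (hα1 : α < 1)
    (μ : Ω → ℝ) (hμ : IsPrior μ) (hμpos : ∀ ω, 0 < μ ω)
    (u : S → Ω → ℝ) (κ : ℝ) (hκ : 0 < κ)
    (Pstar : Ω → S → ℝ) (hopt : IsAlphaRIOptimum α u κ μ Pstar) :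
    ∀ a : S, 0 < (∑ ω, μ ω * Pstar ω a) → ∀ ω : Ω, 0 < Pstar ω a := by
  intro a ha ω₀
  obtain ⟨hP, hmax⟩ := hopt
  refine (hP.1 ω₀ a).lt_of_ne' fun ha0 => ?_
  obtain ⟨b, -, hb⟩ : ∃ b ∈ Finset.univ, 0 < Pstar ω₀ b :=
    Finset.exists_lt_of_sum_lt (f := fun _ : S => (0 : ℝ)) (by simp [hP.2 ω₀])
  have hab : a ≠ b := by
    rintro rfl
    exact hb.ne' ha0
  have hterm (s : S) (ω : Ω) : 0 ≤ μ ω * Pstar ω s ^ α :=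
    mul_nonneg (hμ.1 ω) (rpow_nonneg (hP.1 ω s) _)
  have hcol (s : S) : 0 ≤ ∑ ω, μ ω * Pstar ω s ^ α := Finset.sum_nonneg fun ω _ => hterm s ω
  have hA : 0 < ∑ ω, μ ω * Pstar ω a ^ α := by
    obtain ⟨ω, -, hω⟩ : ∃ ω ∈ Finset.univ, 0 < μ ω * Pstar ω a :=
      Finset.exists_lt_of_sum_lt (f := fun _ : Ω => (0 : ℝ)) (by simpa using ha)
    exact Finset.sum_pos' (fun ω _ => hterm a ω) ⟨ω, Finset.mem_univ ω,
      mul_pos (hμpos ω) (rpow_pos_of_pos (pos_of_mul_pos_right hω (hμ.1 ω)) _)⟩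
  have hG : 0 < ∑ s, (∑ ω, μ ω * Pstar ω s ^ α) ^ (1 / α) :=
    Finset.sum_pos' (fun s _ => rpow_nonneg (hcol s) _) ⟨a, Finset.mem_univ a, rpow_pos_of_pos hA _⟩
  have hc : 0 < -(κ * (α / (α - 1))) :=
    neg_pos.2 (mul_neg_of_pos_of_neg hκ (div_neg_of_pos_of_neg hα0 (by linarith)))
  have hK : 0 < (∑ ω, μ ω * Pstar ω a ^ α) ^ (1 / α) *
      (μ ω₀ * Pstar ω₀ b ^ α / ∑ ω, μ ω * Pstar ω a ^ α) :=
    mul_pos (rpow_pos_of_pos hA _)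
      (div_pos (mul_pos (hμpos _) (rpow_pos_of_pos hb _)) hA)
  obtain ⟨δ, hδ0, hδ1, hpos, hgain⟩ := exists_linear_loss_lt_log_gain hα0 hα1 hc hG hK
    (rpow_nonneg (hcol b) (1 / α)) (-(μ ω₀ * Pstar ω₀ b * (u a ω₀ - u b ω₀)))
  have hlog := log_le_log hpos
    (le_sum_rpow_shiftMass hα0 hα1 hμ.1 hP hab ha0 hA hδ0.le hδ1)
  have hopt := hmax (shiftMass Pstar ω₀ a b (Pstar ω₀ b * δ))
    (isExperiment_shiftMass hP hab (by positivity) (mul_le_of_le_one_right hb.le hδ1))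
  rw [expectedUtility_shiftMass] at hopt
  unfold alphaMI at hopt
  have hscaled := mul_le_mul_of_nonneg_left hlog hc.le
  linarith
end

section
/- (Learning with certainty for α > 1.) Fix α ∈ (1,∞), a prior μ with μ(ω) > 0 for all ω ∈ Ω, κ > 0, and a utility u : S × Ω → ℝ with S identified with the states' optimal actions and all payoffs distinct in each state, i.e. for every ω and all a ≠ b one has u(a,ω) ≠ u(b,ω). Then there exists a scalar π > 0 such that every α-RI optimum P*_π for the scaled utility π·u satisfies: for every action a with μ(P*_π)_S(a) > 0 and every state ω, if P*_π(a|ω) > 0 then u(a,ω) > u(b,ω) for all b ≠ a. Equivalently, every posterior γ^a induced by P*_π puts probability one on the event E_a := {ω : u(a,ω) > u(b,ω) for all b ≠ a}. -/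
open Real Finset

/-- The weighted `α`-norm `(∑ ω, μ ω * f ω ^ α) ^ (1 / α)` satisfies the triangle inequality. -/
lemma weighted_rpow_norm_add_le {Ω : Type*} [Fintype Ω] {α : ℝ} (hα : 1 ≤ α) {μ f g : Ω → ℝ}
    (hμ : ∀ ω, 0 ≤ μ ω) (hf : ∀ ω, 0 ≤ f ω) (hg : ∀ ω, 0 ≤ g ω) :
    (∑ ω, μ ω * (f ω + g ω) ^ α) ^ (1 / α) ≤
      (∑ ω, μ ω * f ω ^ α) ^ (1 / α) + (∑ ω, μ ω * g ω ^ α) ^ (1 / α) := by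
  have hα0 : α ≠ 0 := by linarith
  have hw (ω : Ω) : 0 ≤ μ ω ^ (1 / α) := Real.rpow_nonneg (hμ ω) _
  have key (ω : Ω) (x : ℝ) (hx : 0 ≤ x) : (μ ω ^ (1 / α) * x) ^ α = μ ω * x ^ α := by
    rw [Real.mul_rpow (hw ω) hx, ← Real.rpow_mul (hμ ω), one_div_mul_cancel hα0, Real.rpow_one]
  have h := Real.Lp_add_le_of_nonneg (s := Finset.univ) hα
    (f := fun ω => μ ω ^ (1 / α) * f ω) (g := fun ω => μ ω ^ (1 / α) * g ω)
    (fun ω _ => mul_nonneg (hw ω) (hf ω)) (fun ω _ => mul_nonneg (hw ω) (hg ω))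
  simp only [← mul_add] at h
  simpa only [key _ _ (hf _), key _ _ (hg _), key _ _ (add_nonneg (hf _) (hg _))] using h

/-- The argument of the logarithm in `alphaMI` is at least one when `1 ≤ α`. -/
lemma IsExperiment.one_le_sum_rpow {Ω S : Type*} [Fintype Ω] [Fintype S] {α : ℝ} (hα : 1 ≤ α)
    {μ : Ω → ℝ} (hμ : IsPrior μ) {P : Ω → S → ℝ} (hP : IsExperiment P) :
    1 ≤ ∑ s, (∑ ω, μ ω * P ω s ^ α) ^ (1 / α) := by
  calc (1 : ℝ) = ∑ s, ∑ ω, μ ω * P ω s := by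
        rw [Finset.sum_comm]
        simp only [← Finset.mul_sum, hP.2, mul_one, hμ.2]
    _ ≤ _ := Finset.sum_le_sum fun s _ =>
        Real.arith_mean_le_rpow_mean _ μ _ (fun ω _ => hμ.1 ω) hμ.2 (fun ω _ => hP.1 ω s) hα

open Classical in
/-- Move all the mass that `P` puts on signal `a` in state `ω₀` to signal `b`. -/
noncomputable def moveMass {Ω S : Type*} (P : Ω → S → ℝ) (ω₀ : Ω) (a b : S) : Ω → S → ℝ :=
  fun ω s => P ω s +
    (if ω = ω₀ then P ω₀ a else 0) * ((if s = b then 1 else 0) - (if s = a then 1 else 0))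

lemma IsExperiment.isExperiment_moveMass {Ω S : Type*} [Fintype Ω] [Fintype S] {P : Ω → S → ℝ}
    (hP : IsExperiment P) (ω₀ : Ω) {a b : S} (hab : b ≠ a) :
    IsExperiment (moveMass P ω₀ a b) := by
  classical
  refine ⟨fun ω s => ?_, fun ω => ?_⟩
  · have h1 := hP.1 ω s
    have h2 := hP.1 ω₀ a
    unfold moveMass
    by_cases hω : ω = ω₀ <;> by_cases hb : s = b <;> by_cases ha : s = a <;>
      simp_all [add_nonneg]
  · simp [moveMass, Finset.sum_add_distrib, ← Finset.mul_sum, hP.2]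

lemma sum_mul_moveMass_mul {Ω S : Type*} [Fintype Ω] [Fintype S] (μ : Ω → ℝ) (P : Ω → S → ℝ)
    (v : S → Ω → ℝ) (ω₀ : Ω) (a b : S) :
    ∑ ω, ∑ s, μ ω * moveMass P ω₀ a b ω s * v s ω =
      (∑ ω, ∑ s, μ ω * P ω s * v s ω) + μ ω₀ * P ω₀ a * (v b ω₀ - v a ω₀) := by
  classical
  have h (ω : Ω) (s : S) : μ ω * moveMass P ω₀ a b ω s * v s ω = μ ω * P ω s * v s ω +
      μ ω * (if ω = ω₀ then P ω₀ a else 0) *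
        ((if s = b then v s ω else 0) - (if s = a then v s ω else 0)) := by
    unfold moveMass
    split_ifs <;> ring
  simp [h, Finset.sum_add_distrib, ← Finset.mul_sum]

lemma IsExperiment.sum_rpow_moveMass_le {Ω S : Type*} [Fintype Ω] [Fintype S] {α : ℝ}
    (hα : 1 ≤ α) {μ : Ω → ℝ} (hμ : ∀ ω, 0 ≤ μ ω) {P : Ω → S → ℝ} (hP : IsExperiment P)
    (ω₀ : Ω) {a b : S} (hab : b ≠ a) :
    ∑ s, (∑ ω, μ ω * moveMass P ω₀ a b ω s ^ α) ^ (1 / α) ≤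
      ∑ s, (∑ ω, μ ω * P ω s ^ α) ^ (1 / α) + P ω₀ a * μ ω₀ ^ (1 / α) := by
  classical
  have hα0 : α ≠ 0 := by linarith
  have hcol (s : S) : (∑ ω, μ ω * moveMass P ω₀ a b ω s ^ α) ^ (1 / α) ≤
      (∑ ω, μ ω * P ω s ^ α) ^ (1 / α) + if s = b then P ω₀ a * μ ω₀ ^ (1 / α) else 0 := by
    by_cases hs : s = b
    · subst hs
      have hg (ω : Ω) : 0 ≤ if ω = ω₀ then P ω₀ a else 0 := by
        split_ifs
        exacts [hP.1 _ _, le_rfl]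
      have h := weighted_rpow_norm_add_le hα hμ (fun ω => hP.1 ω s) hg
      have hsum : ∑ ω, μ ω * (if ω = ω₀ then P ω₀ a else 0) ^ α = μ ω₀ * P ω₀ a ^ α := by
        rw [Finset.sum_eq_single ω₀] <;> simp +contextual [Real.zero_rpow hα0]
      rw [hsum, Real.mul_rpow (hμ _) (Real.rpow_nonneg (hP.1 _ _) _),
        ← Real.rpow_mul (hP.1 _ _), mul_one_div_cancel hα0, Real.rpow_one, mul_comm (_ ^ _)] at h
      simpa [moveMass, hab] using h
    · have hnn := (hP.isExperiment_moveMass ω₀ hab).1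
      simp only [hs, if_false, add_zero]
      refine Real.rpow_le_rpow
        (Finset.sum_nonneg fun ω _ => mul_nonneg (hμ ω) (Real.rpow_nonneg (hnn ω s) _))
        (Finset.sum_le_sum fun ω _ => mul_le_mul_of_nonneg_left
          (Real.rpow_le_rpow (hnn ω s) ?_ (by linarith)) (hμ ω)) (by positivity)
      have h0 := hP.1 ω₀ a
      unfold moveMass
      by_cases hω : ω = ω₀ <;> by_cases ha : s = a <;> simp_all
  refine (Finset.sum_le_sum fun s _ => hcol s).trans_eq ?_
  simp [Finset.sum_add_distrib]

lemma IsExperiment.alphaMI_moveMass_le {Ω S : Type*} [Fintype Ω] [Fintype S] {α : ℝ}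
    (hα : 1 < α) {μ : Ω → ℝ} (hμ : IsPrior μ) {P : Ω → S → ℝ} (hP : IsExperiment P)
    (ω₀ : Ω) {a b : S} (hab : b ≠ a) :
    alphaMI α (moveMass P ω₀ a b) μ ≤
      alphaMI α P μ + α / (α - 1) * (P ω₀ a * μ ω₀ ^ (1 / α)) := by
  have hK : 0 ≤ α / (α - 1) := div_nonneg (by linarith) (by linarith)
  have h1 := hP.one_le_sum_rpow hα.le hμ
  have h1' := (hP.isExperiment_moveMass ω₀ hab).one_le_sum_rpow hα.le hμ
  have hle := hP.sum_rpow_moveMass_le hα.le hμ.1 ω₀ hab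
  have hx : 0 ≤ P ω₀ a * μ ω₀ ^ (1 / α) :=
    mul_nonneg (hP.1 _ _) (Real.rpow_nonneg (hμ.1 _) _)
  unfold alphaMI
  rw [← mul_add]
  refine mul_le_mul_of_nonneg_left ?_ hK
  generalize (∑ s, (∑ ω, μ ω * P ω s ^ α) ^ (1 / α)) = G at *
  generalize (∑ s, (∑ ω, μ ω * moveMass P ω₀ a b ω s ^ α) ^ (1 / α)) = G' at *
  generalize P ω₀ a * μ ω₀ ^ (1 / α) = x at *
  have hG : 0 < G := by linarith
  have hlog := Real.log_le_sub_one_of_pos (show 0 < G' / G by positivity)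
  rw [Real.log_div (by linarith) hG.ne'] at hlog
  have hdiv : G' / G ≤ 1 + x := by
    rw [div_le_iff₀ hG]
    nlinarith
  linarith

theorem learning_with_certainty_of_one_lt_alpha
    {Ω S : Type*} [Fintype Ω] [Fintype S]
    (α : ℝ) (hα : 1 < α)
    (μ : Ω → ℝ) (hμ : IsPrior μ) (hμpos : ∀ ω, 0 < μ ω)
    (κ : ℝ) (hκ : 0 < κ)
    (u : S → Ω → ℝ)
    (hdistinct : ∀ ω : Ω, ∀ a b : S, a ≠ b → u a ω ≠ u b ω) :
    ∃ c : ℝ, 0 < c ∧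
      ∀ Pstar : Ω → S → ℝ,
        IsAlphaRIOptimum α (fun s ω => c * u s ω) κ μ Pstar →
        ∀ a : S, 0 < (∑ ω, μ ω * Pstar ω a) →
          ∀ ω : Ω, 0 < Pstar ω a → ∀ b : S, b ≠ a → u b ω < u a ω := by
  obtain ⟨M, hM⟩ := Finite.exists_le fun p : Ω × S × S =>
    κ * (α / (α - 1)) * μ p.1 ^ (1 / α) / (μ p.1 * (u p.2.2 p.1 - u p.2.1 p.1))
  refine ⟨max M 0 + 1, by positivity, fun P hopt a _ ω hPa b hb => ?_⟩
  by_contra hlt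
  have hgap : 0 < u b ω - u a ω :=
    sub_pos.2 (lt_of_le_of_ne (not_lt.1 hlt) (hdistinct ω a b hb.symm))
  have hc := (hM (ω, a, b)).trans_lt (lt_of_le_of_lt (le_max_left M 0) (lt_add_one _))
  rw [div_lt_iff₀ (mul_pos (hμpos ω) hgap)] at hc
  have hU := hopt.2 _ (hopt.1.isExperiment_moveMass ω hb)
  rw [sum_mul_moveMass_mul] at hU
  have hI := mul_le_mul_of_nonneg_left (hopt.1.alphaMI_moveMass_le hα hμ ω hb) hκ.le
  have hstrict := mul_lt_mul_of_pos_left hc hPa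
  linarith
end

section
/- (Utility cost curve in the binary symmetric problem.) Let Ω = {ω₁, ω₂}, S = {a, b}, let μ be the uniform prior μ(ω₁) = μ(ω₂) = 1/2, and let the utility be u(a,ω₁) = u(b,ω₂) = 1 and u(a,ω₂) = u(b,ω₁) = 0. Fix α ∈ (0,1)∪(1,∞). For every v ∈ [1/2, 1], the minimum of I_α(P,μ) over statistical experiments P satisfying Σ_{ω,s} μ(ω)P(s|ω)u(s,ω) ≥ v equals K̄_α(v) := (α/(α−1))·log(2·((1/2)·(v^α + (1−v)^α))^{1/α}), and this minimum is attained by the symmetric experiment with P(a|ω₁) = P(b|ω₂) = v. -/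
open Real Finset

/-- Reverse Minkowski inequality for two nonnegative pairs and an exponent in `(0, 1]`. -/
theorem add_rpow_sum_le_rpow_sum_add {p x₁ y₁ x₂ y₂ : ℝ} (hp0 : 0 < p) (hp1 : p ≤ 1)
    (hx₁ : 0 ≤ x₁) (hy₁ : 0 ≤ y₁) (hx₂ : 0 ≤ x₂) (hy₂ : 0 ≤ y₂) :
    (x₁ ^ p + y₁ ^ p) ^ (1 / p) + (x₂ ^ p + y₂ ^ p) ^ (1 / p)
      ≤ ((x₁ + x₂) ^ p + (y₁ + y₂) ^ p) ^ (1 / p) := by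
  have eq_zero {x y : ℝ} (hx : 0 ≤ x) (hy : 0 ≤ y) (h : x ^ p + y ^ p = 0) :
      x = 0 ∧ y = 0 := by
    have hxp := rpow_nonneg hx p
    have hyp := rpow_nonneg hy p
    exact ⟨(rpow_eq_zero hx hp0.ne').1 (by linarith), (rpow_eq_zero hy hp0.ne').1 (by linarith)⟩
  have hM : 0 ≤ x₁ ^ p + y₁ ^ p := by positivity
  have hN : 0 ≤ x₂ ^ p + y₂ ^ p := by positivity
  rcases hM.eq_or_lt with hM | hM
  · obtain ⟨rfl, rfl⟩ := eq_zero hx₁ hy₁ hM.symm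
    simp [hp0.ne']
  rcases hN.eq_or_lt with hN | hN
  · obtain ⟨rfl, rfl⟩ := eq_zero hx₂ hy₂ hN.symm
    simp [hp0.ne']
  set A := (x₁ ^ p + y₁ ^ p) ^ (1 / p) with hA
  set B := (x₂ ^ p + y₂ ^ p) ^ (1 / p) with hB
  have hA0 : 0 < A := rpow_pos_of_pos hM _
  have hB0 : 0 < B := rpow_pos_of_pos hN _
  have hAp : A ^ p = x₁ ^ p + y₁ ^ p := by
    rw [hA, ← rpow_mul hM.le, one_div_mul_cancel hp0.ne', rpow_one]
  have hBp : B ^ p = x₂ ^ p + y₂ ^ p := by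
    rw [hB, ← rpow_mul hN.le, one_div_mul_cancel hp0.ne', rpow_one]
  have key {x y : ℝ} (hx : 0 ≤ x) (hy : 0 ≤ y) :
      A / (A + B) * (x ^ p / A ^ p) + B / (A + B) * (y ^ p / B ^ p)
        ≤ (x + y) ^ p / (A + B) ^ p := by
    have h := (concaveOn_rpow hp0.le hp1).2
      (Set.mem_Ici.2 (div_nonneg hx hA0.le)) (Set.mem_Ici.2 (div_nonneg hy hB0.le))
      (show 0 ≤ A / (A + B) by positivity) (show 0 ≤ B / (A + B) by positivity) (by field_simp)
    have e : A / (A + B) * (x / A) + B / (A + B) * (y / B) = (x + y) / (A + B) := by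
      field_simp
    simp only [smul_eq_mul] at h
    rwa [e, div_rpow hx hA0.le, div_rpow hy hB0.le, div_rpow (by positivity) (by positivity)] at h
  have hsum := add_le_add (key hx₁ hx₂) (key hy₁ hy₂)
  have e : A / (A + B) * (x₁ ^ p / A ^ p) + B / (A + B) * (x₂ ^ p / B ^ p)
      + (A / (A + B) * (y₁ ^ p / A ^ p) + B / (A + B) * (y₂ ^ p / B ^ p)) = 1 := by
    rw [hAp, hBp]
    field_simp
    ring
  rw [e, ← add_div, one_le_div (by positivity)] at hsum
  calc A + B = ((A + B) ^ p) ^ (1 / p) := by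
        rw [← rpow_mul (by positivity), mul_one_div_cancel hp0.ne', rpow_one]
    _ ≤ _ := rpow_le_rpow (by positivity) hsum (by positivity)

/-- Minkowski inequality for two nonnegative pairs. -/
theorem rpow_sum_add_le_add_rpow_sum {p x₁ y₁ x₂ y₂ : ℝ} (hp : 1 ≤ p)
    (hx₁ : 0 ≤ x₁) (hy₁ : 0 ≤ y₁) (hx₂ : 0 ≤ x₂) (hy₂ : 0 ≤ y₂) :
    ((x₁ + x₂) ^ p + (y₁ + y₂) ^ p) ^ (1 / p)
      ≤ (x₁ ^ p + y₁ ^ p) ^ (1 / p) + (x₂ ^ p + y₂ ^ p) ^ (1 / p) := by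
  have h := Real.Lp_add_le_of_nonneg (s := (Finset.univ : Finset (Fin 2))) (f := ![x₁, y₁])
    (g := ![x₂, y₂]) hp (by simp [Fin.forall_fin_two, hx₁, hy₁])
    (by simp [Fin.forall_fin_two, hx₂, hy₂])
  simpa [Fin.sum_univ_two] using h

/-- A convex function satisfies `g v + g (1 - v) ≤ g s + g (1 - s)` when `s` is at least as far
from `1 / 2` as `v` is. -/
theorem ConvexOn.add_one_sub_le {S : Set ℝ} {g : ℝ → ℝ} (hg : ConvexOn ℝ S g) {v s : ℝ}
    (hs : s ∈ S) (hs' : 1 - s ∈ S) (hv : 1 / 2 ≤ v) (hvs : v ≤ s) :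
    g v + g (1 - v) ≤ g s + g (1 - s) := by
  rcases hvs.eq_or_lt with rfl | hlt
  · rfl
  have hd : 0 < 2 * s - 1 := by linarith
  have hd' := hd.ne'
  have ha : 0 ≤ (v + s - 1) / (2 * s - 1) := div_nonneg (by linarith) hd.le
  have hb : 0 ≤ (s - v) / (2 * s - 1) := div_nonneg (by linarith) hd.le
  have hab : (v + s - 1) / (2 * s - 1) + (s - v) / (2 * s - 1) = 1 := by
    rw [← add_div, div_eq_one_iff_eq hd']
    ring
  have h₁ := hg.2 hs hs' ha hb hab
  have h₂ := hg.2 hs' hs ha hb hab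
  have e₁ : (v + s - 1) / (2 * s - 1) * s + (s - v) / (2 * s - 1) * (1 - s) = v := by
    rw [div_mul_eq_mul_div, div_mul_eq_mul_div, ← add_div, div_eq_iff hd']
    ring
  have e₂ : (v + s - 1) / (2 * s - 1) * (1 - s) + (s - v) / (2 * s - 1) * s = 1 - v := by
    rw [div_mul_eq_mul_div, div_mul_eq_mul_div, ← add_div, div_eq_iff hd']
    ring
  simp only [smul_eq_mul] at h₁ h₂
  rw [e₁] at h₁
  rw [e₂] at h₂
  linear_combination h₁ + h₂ + (g s + g (1 - s)) * hab

theorem alphaMI_uniform_fin_two (α : ℝ) (P : Fin 2 → Fin 2 → ℝ) (hP : ∀ ω s, 0 ≤ P ω s) :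
    alphaMI α P (fun _ : Fin 2 => (1 / 2 : ℝ)) = (α / (α - 1)) * Real.log ((1 / 2) ^ (1 / α) *
      ((P 0 0 ^ α + P 1 0 ^ α) ^ (1 / α) + (P 1 1 ^ α + P 0 1 ^ α) ^ (1 / α))) := by
  have h₁ : 0 ≤ P 0 0 ^ α + P 1 0 ^ α := add_nonneg (rpow_nonneg (hP _ _) _) (rpow_nonneg (hP _ _) _)
  have h₂ : 0 ≤ P 1 1 ^ α + P 0 1 ^ α := add_nonneg (rpow_nonneg (hP _ _) _) (rpow_nonneg (hP _ _) _)
  rw [mul_add, ← mul_rpow (by norm_num) h₁, ← mul_rpow (by norm_num) h₂]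
  simp only [alphaMI, Fin.sum_univ_two, ← mul_add, add_comm (P 0 1 ^ α)]

theorem two_mul_rpow_add_rpow {α s t : ℝ} (hα : 0 < α) (hs : 0 ≤ s) (ht : 0 ≤ t) :
    ((2 * s) ^ α + (2 * t) ^ α) ^ (1 / α) = 2 * (s ^ α + t ^ α) ^ (1 / α) := by
  rw [mul_rpow (by norm_num) hs, mul_rpow (by norm_num) ht, ← mul_add,
    mul_rpow (by positivity) (by positivity), ← rpow_mul (by norm_num),
    mul_one_div_cancel hα.ne', rpow_one]


theorem binary_symmetric_utility_cost_curve
    (α : ℝ) (hα0 : 0 < α) (hα1 : α ≠ 1)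
    (v : ℝ) (hv : v ∈ Set.Icc (1 / 2 : ℝ) 1) :
    IsLeast {x : ℝ | ∃ P : Fin 2 → Fin 2 → ℝ, IsExperiment P ∧
        v ≤ (∑ ω, ∑ s, (1 / 2 : ℝ) * P ω s * (if s = ω then 1 else 0)) ∧
        x = alphaMI α P (fun _ : Fin 2 => (1 / 2 : ℝ))}
      ((α / (α - 1)) * Real.log (2 * ((1 / 2) * (v ^ α + (1 - v) ^ α)) ^ (1 / α)))
    ∧ alphaMI α (fun ω s : Fin 2 => if s = ω then v else 1 - v)
        (fun _ : Fin 2 => (1 / 2 : ℝ))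
        = (α / (α - 1)) * Real.log (2 * ((1 / 2) * (v ^ α + (1 - v) ^ α)) ^ (1 / α)) := by
  obtain ⟨hv₁, hv₂⟩ := hv
  have hv0 : 0 < v := by linarith
  have hv' : 0 ≤ 1 - v := by linarith
  have hV : 0 < v ^ α + (1 - v) ^ α :=
    add_pos_of_pos_of_nonneg (rpow_pos_of_pos hv0 _) (rpow_nonneg hv' _)
  have hcurve : (2 : ℝ) * ((1 / 2) * (v ^ α + (1 - v) ^ α)) ^ (1 / α)
      = (1 / 2) ^ (1 / α) * (2 * (v ^ α + (1 - v) ^ α) ^ (1 / α)) := by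
    rw [mul_rpow (by norm_num) hV.le]
    ring
  have hsymm : alphaMI α (fun ω s : Fin 2 => if s = ω then v else 1 - v)
        (fun _ : Fin 2 => (1 / 2 : ℝ))
        = (α / (α - 1)) * Real.log (2 * ((1 / 2) * (v ^ α + (1 - v) ^ α)) ^ (1 / α)) := by
    rw [alphaMI_uniform_fin_two _ _ (by intro ω s; split_ifs <;> linarith), hcurve]
    simp [two_mul]
  refine ⟨⟨⟨fun ω s => if s = ω then v else 1 - v, ⟨?_, ?_⟩, ?_, hsymm.symm⟩, ?_⟩, hsymm⟩
  · intro ω s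
    dsimp only
    split_ifs <;> linarith
  · simp [Fin.forall_fin_two, Fin.sum_univ_two]
  · simp only [Fin.sum_univ_two]
    norm_num
    linarith
  · rintro x ⟨P, ⟨hP, hP₁⟩, hvP, rfl⟩
    have hP₀ := hP₁ 0
    have hP₁ := hP₁ 1
    simp only [Fin.sum_univ_two] at hP₀ hP₁ hvP
    norm_num at hvP
    have h00 := hP 0 0
    have h01 := hP 0 1
    have h10 := hP 1 0
    have h11 := hP 1 1
    obtain ⟨s, hs⟩ : ∃ s, P 0 0 + P 1 1 = 2 * s := ⟨(P 0 0 + P 1 1) / 2, by ring⟩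
    have ht : P 1 0 + P 0 1 = 2 * (1 - s) := by linarith
    have hvs : v ≤ s := by linarith
    have hs0 : 0 ≤ s := by linarith
    have hs1 : 0 ≤ 1 - s := by linarith
    have hSum : 0 < (P 0 0 ^ α + P 1 0 ^ α) ^ (1 / α) + (P 1 1 ^ α + P 0 1 ^ α) ^ (1 / α) := by
      rcases h00.eq_or_lt with h | h
      · have : 0 < P 0 1 := by linarith
        positivity
      · positivity
    rw [alphaMI_uniform_fin_two α P hP, hcurve]
    rcases lt_or_gt_of_ne hα1 with hα | hα
    · refine mul_le_mul_of_nonpos_left (Real.log_le_log (by positivity) ?_)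
        (div_nonpos_of_nonneg_of_nonpos hα0.le (by linarith))
      refine mul_le_mul_of_nonneg_left ?_ (by positivity)
      refine (add_rpow_sum_le_rpow_sum_add hα0 hα.le h00 h10 h11 h01).trans ?_
      rw [hs, ht, two_mul_rpow_add_rpow hα0 hs0 hs1]
      have hmono := (concaveOn_rpow hα0.le hα.le).neg.add_one_sub_le hs0 hs1 hv₁ hvs
      simp only [Pi.neg_apply] at hmono
      gcongr 2 * ?_ ^ (1 / α)
      linarith
    · refine mul_le_mul_of_nonneg_left (Real.log_le_log (by positivity) ?_)
        (div_nonneg hα0.le (by linarith))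
      refine mul_le_mul_of_nonneg_left ?_ (by positivity)
      refine le_trans ?_ (rpow_sum_add_le_add_rpow_sum hα.le h00 h10 h11 h01)
      rw [hs, ht, two_mul_rpow_add_rpow hα0 hs0 hs1]
      gcongr 2 * ?_ ^ (1 / α)
      exact (convexOn_rpow hα.le).add_one_sub_le hs0 hs1 hv₁ hvs
end

section
/- (Slope of the utility cost curve at full information.) For α ∈ (0,1)∪(1,∞) define K̄_α : (1/2, 1) → ℝ by K̄_α(v) := (α/(α−1))·log(2·((1/2)·(v^α + (1−v)^α))^{1/α}). Then K̄_α is differentiable on (1/2,1) with K̄_α′(v) = (α/(α−1))·(v^{α−1} − (1−v)^{α−1})/(v^α + (1−v)^α); moreover if α ∈ (0,1) then K̄_α′(v) → +∞ as v → 1⁻, while if α > 1 then K̄_α′(v) → α/(α−1) as v → 1⁻. Additionally, the Shannon analogue K̄₁(v) := v·log v + (1−v)·log(1−v) + log 2 satisfies K̄₁′(v) = log(v/(1−v)) → +∞ as v → 1⁻. -/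
open Real Filter

theorem tendsto_one_sub_nhdsLT_one :
    Tendsto (fun v : ℝ => 1 - v) (nhdsWithin 1 (Set.Iio 1)) (nhdsWithin 0 (Set.Ioi 0)) := by
  refine tendsto_nhdsWithin_iff.2 ⟨?_, ?_⟩
  · exact ((continuous_const.sub continuous_id).tendsto' (1 : ℝ) 0 (by simp)).mono_left
      nhdsWithin_le_nhds
  · filter_upwards [self_mem_nhdsWithin] with v hv
    exact sub_pos.2 (Set.mem_Iio.1 hv)

theorem tendsto_rpow_nhdsLT_one (p : ℝ) :
    Tendsto (fun v : ℝ => v ^ p) (nhdsWithin 1 (Set.Iio 1)) (nhds 1) := by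
  have h := (Real.continuousAt_rpow_const (1 : ℝ) p (Or.inl one_ne_zero)).tendsto
  rw [Real.one_rpow] at h
  exact h.mono_left nhdsWithin_le_nhds

theorem tendsto_one_sub_rpow_nhdsLT_one {p : ℝ} (hp : 0 < p) :
    Tendsto (fun v : ℝ => (1 - v) ^ p) (nhdsWithin 1 (Set.Iio 1)) (nhds 0) := by
  have h := (Real.continuousAt_rpow_const (0 : ℝ) p (Or.inr hp.le)).tendsto
  rw [Real.zero_rpow hp.ne'] at h
  exact h.comp (tendsto_one_sub_nhdsLT_one.mono_right nhdsWithin_le_nhds)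

theorem tendsto_rpow_add_one_sub_rpow_nhdsLT_one {α : ℝ} (hα : 0 < α) :
    Tendsto (fun v : ℝ => v ^ α + (1 - v) ^ α) (nhdsWithin 1 (Set.Iio 1)) (nhds 1) := by
  simpa using (tendsto_rpow_nhdsLT_one α).add (tendsto_one_sub_rpow_nhdsLT_one hα)

theorem hasDerivAt_utility_cost {α v : ℝ} (hα : α ≠ 0) (hv0 : 0 < v) (hv1 : v < 1) :
    HasDerivAt
      (fun w : ℝ => (α / (α - 1)) *
        Real.log (2 * ((1 / 2) * (w ^ α + (1 - w) ^ α)) ^ (1 / α)))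
      ((α / (α - 1)) * (v ^ (α - 1) - (1 - v) ^ (α - 1)) / (v ^ α + (1 - v) ^ α)) v := by
  have hw : 0 < 1 - v := sub_pos.2 hv1
  have hS : 0 < v ^ α + (1 - v) ^ α := add_pos (rpow_pos_of_pos hv0 α) (rpow_pos_of_pos hw α)
  have hT : 0 < (1 / 2) * (v ^ α + (1 - v) ^ α) := by positivity
  have hsum := ((hasDerivAt_id v).rpow_const (p := α) (Or.inl hv0.ne')).add
    (((hasDerivAt_id v).const_sub 1).rpow_const (p := α) (Or.inl hw.ne'))
  have hP := rpow_pos_of_pos hT (1 / α)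
  have h := ((((hsum.const_mul (1 / 2)).rpow_const (p := 1 / α) (Or.inl hT.ne')).const_mul
    2).log (mul_pos two_pos hP).ne').const_mul (α / (α - 1))
  refine h.congr_deriv ?_
  simp only [Pi.add_apply, id_eq]
  rw [rpow_sub_one hT.ne' (1 / α), mul_div_assoc (α / (α - 1))]
  congr 1
  generalize ((1 / 2) * (v ^ α + (1 - v) ^ α)) ^ (1 / α) = P at hP ⊢
  generalize v ^ α + (1 - v) ^ α = S at hS ⊢
  field_simp
  ring

theorem hasDerivAt_shannon_cost {v : ℝ} (hv0 : 0 < v) (hv1 : v < 1) :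
    HasDerivAt
      (fun w : ℝ => w * Real.log w + (1 - w) * Real.log (1 - w) + Real.log 2)
      (Real.log (v / (1 - v))) v := by
  have hw : 1 - v ≠ 0 := (sub_pos.2 hv1).ne'
  have h := ((hasDerivAt_mul_log hv0.ne').add
    ((hasDerivAt_mul_log hw).comp v ((hasDerivAt_id v).const_sub 1))).add_const (Real.log 2)
  refine h.congr_deriv ?_
  rw [Real.log_div hv0.ne' hw]
  ring

theorem tendsto_utility_cost_slope_atTop {α : ℝ} (hα0 : 0 < α) (hα1 : α < 1) :
    Tendsto
      (fun v : ℝ =>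
        (α / (α - 1)) * (v ^ (α - 1) - (1 - v) ^ (α - 1)) / (v ^ α + (1 - v) ^ α))
      (nhdsWithin 1 (Set.Iio 1)) atTop := by
  have hc : α / (α - 1) < 0 := div_neg_of_pos_of_neg hα0 (sub_neg.2 hα1)
  have hbot : Tendsto (fun v : ℝ => v ^ (α - 1) - (1 - v) ^ (α - 1))
      (nhdsWithin 1 (Set.Iio 1)) atBot := by
    simpa only [sub_eq_add_neg, Function.comp_def] using
      (tendsto_rpow_nhdsLT_one (α - 1)).add_atBot (tendsto_neg_atTop_atBot.comp
        ((tendsto_rpow_neg_nhdsGT_zero (sub_neg.2 hα1)).comp tendsto_one_sub_nhdsLT_one))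
  simpa only [div_eq_mul_inv] using (hbot.const_mul_atBot_of_neg hc).atTop_mul_pos
    (inv_pos.2 one_pos) ((tendsto_rpow_add_one_sub_rpow_nhdsLT_one hα0).inv₀ one_ne_zero)

theorem tendsto_utility_cost_slope_of_one_lt {α : ℝ} (hα : 1 < α) :
    Tendsto
      (fun v : ℝ =>
        (α / (α - 1)) * (v ^ (α - 1) - (1 - v) ^ (α - 1)) / (v ^ α + (1 - v) ^ α))
      (nhdsWithin 1 (Set.Iio 1)) (nhds (α / (α - 1))) := by
  simpa [Pi.div_def] using (((tendsto_rpow_nhdsLT_one (α - 1)).sub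
    (tendsto_one_sub_rpow_nhdsLT_one (sub_pos.2 hα))).const_mul (α / (α - 1))).div
    (tendsto_rpow_add_one_sub_rpow_nhdsLT_one (one_pos.trans hα)) one_ne_zero

theorem tendsto_log_div_one_sub_nhdsLT_one :
    Tendsto (fun v : ℝ => Real.log (v / (1 - v))) (nhdsWithin 1 (Set.Iio 1)) atTop := by
  have hid : Tendsto (fun v : ℝ => v) (nhdsWithin 1 (Set.Iio 1)) (nhds 1) := nhdsWithin_le_nhds
  simpa only [div_eq_mul_inv, Function.comp_def] using tendsto_log_atTop.comp
    (hid.pos_mul_atTop one_pos (tendsto_inv_nhdsGT_zero.comp tendsto_one_sub_nhdsLT_one))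

theorem utility_cost_curve_slope
    (α : ℝ) (hα0 : 0 < α) (hα1 : α ≠ 1) :
    (∀ v ∈ Set.Ioo (1 / 2 : ℝ) 1,
      HasDerivAt
        (fun w : ℝ => (α / (α - 1)) *
          Real.log (2 * ((1 / 2) * (w ^ α + (1 - w) ^ α)) ^ (1 / α)))
        ((α / (α - 1)) * (v ^ (α - 1) - (1 - v) ^ (α - 1)) / (v ^ α + (1 - v) ^ α))
        v)
    ∧ (α < 1 →
        Tendsto
          (fun v : ℝ =>
            (α / (α - 1)) * (v ^ (α - 1) - (1 - v) ^ (α - 1)) / (v ^ α + (1 - v) ^ α))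
          (nhdsWithin 1 (Set.Iio 1)) atTop)
    ∧ (1 < α →
        Tendsto
          (fun v : ℝ =>
            (α / (α - 1)) * (v ^ (α - 1) - (1 - v) ^ (α - 1)) / (v ^ α + (1 - v) ^ α))
          (nhdsWithin 1 (Set.Iio 1)) (nhds (α / (α - 1))))
    ∧ (∀ v ∈ Set.Ioo (1 / 2 : ℝ) 1,
        HasDerivAt
          (fun w : ℝ => w * Real.log w + (1 - w) * Real.log (1 - w) + Real.log 2)
          (Real.log (v / (1 - v))) v)
    ∧ Tendsto (fun v : ℝ => Real.log (v / (1 - v)))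
        (nhdsWithin 1 (Set.Iio 1)) atTop := by
  have pos_of_mem {v : ℝ} (hv : v ∈ Set.Ioo (1 / 2 : ℝ) 1) : 0 < v := one_half_pos.trans hv.1
  exact ⟨fun v hv => hasDerivAt_utility_cost hα0.ne' (pos_of_mem hv) hv.2,
    tendsto_utility_cost_slope_atTop hα0, tendsto_utility_cost_slope_of_one_lt,
    fun v hv => hasDerivAt_shannon_cost (pos_of_mem hv) hv.2, tendsto_log_div_one_sub_nhdsLT_one⟩
end

section
/- (Rényi divergence is hemivariate in its first argument.) Let X be a finite set, α ∈ (0,1)∪(1,∞), and Q a probability vector on X with Q(x) > 0 for all x. Let P₀ ≠ P₁ be probability vectors on X and for λ ∈ [0,1] set P_λ := λ·P₀ + (1−λ)·P₁. Then the function λ ↦ D_α(P_λ ‖ Q) := (1/(α−1))·log Σ_{x∈X} P_λ(x)^α · Q(x)^{1−α} is not constant on [0,1]. -/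
open Real Finset

/-- A probability vector on a finite set. -/
def IsProbVec {X : Type*} [Fintype X] (p : X → ℝ) : Prop :=
  (∀ x, 0 ≤ p x) ∧ ∑ x, p x = 1

/-- The Rényi divergence of order α between finite probability vectors. -/
noncomputable def renyiDiv {X : Type*} [Fintype X] (α : ℝ) (p q : X → ℝ) : ℝ :=
  (1 / (α - 1)) * Real.log (∑ x, p x ^ α * q x ^ (1 - α))

/-- A weighted sum, with positive weights, of a strictly convex function of each coordinate is
strictly convex. -/
theorem StrictConvexOn.sum_apply_mul {X : Type*} [Fintype X] {s : Set ℝ} {f : ℝ → ℝ}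
    (hf : StrictConvexOn ℝ s f) {w : X → ℝ} (hw : ∀ x, 0 < w x) :
    StrictConvexOn ℝ (Set.univ.pi fun _ : X => s) fun p => ∑ x, f (p x) * w x := by
  refine ⟨convex_pi fun _ _ => hf.1, fun p hp q hq hpq a b ha hb hab => ?_⟩
  obtain ⟨y, hy⟩ := Function.ne_iff.mp hpq
  simp only [smul_eq_mul, mul_sum, ← sum_add_distrib, Pi.add_apply, Pi.smul_apply]
  refine sum_lt_sum (fun x _ => ?_) ⟨y, mem_univ y, ?_⟩
  · have h := hf.convexOn.2 (hp x trivial) (hq x trivial) ha.le hb.le hab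
    simp only [smul_eq_mul] at h
    linarith [mul_le_mul_of_nonneg_right h (hw x).le]
  · have h := hf.2 (hp y trivial) (hq y trivial) hy ha hb hab
    simp only [smul_eq_mul] at h
    linarith [mul_lt_mul_of_pos_right h (hw y)]

/-- A weighted sum, with positive weights, of a strictly concave function of each coordinate is
strictly concave. -/
theorem StrictConcaveOn.sum_apply_mul {X : Type*} [Fintype X] {s : Set ℝ} {f : ℝ → ℝ}
    (hf : StrictConcaveOn ℝ s f) {w : X → ℝ} (hw : ∀ x, 0 < w x) :
    StrictConcaveOn ℝ (Set.univ.pi fun _ : X => s) fun p => ∑ x, f (p x) * w x := by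
  rw [← neg_strictConvexOn_iff]
  have hneg : (-fun p : X → ℝ => ∑ x, f (p x) * w x) = fun p => ∑ x, (-f) (p x) * w x := by
    ext p
    simp
  rw [hneg]
  exact hf.neg.sum_apply_mul hw

theorem IsProbVec.sum_rpow_mul_rpow_pos {X : Type*} [Fintype X] {p q : X → ℝ}
    (hp : IsProbVec p) (hq : ∀ x, 0 < q x) (a b : ℝ) : 0 < ∑ x, p x ^ a * q x ^ b := by
  obtain ⟨y, -, hy⟩ : ∃ y ∈ univ, 0 < p y := by
    by_contra! h
    linarith [hp.2, sum_nonpos h]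
  exact sum_pos' (fun x _ => mul_nonneg (rpow_nonneg (hp.1 x) _) (rpow_nonneg (hq x).le _))
    ⟨y, mem_univ y, mul_pos (rpow_pos_of_pos hy _) (rpow_pos_of_pos (hq y) _)⟩

theorem IsProbVec.mix {X : Type*} [Fintype X] {p q : X → ℝ} (hp : IsProbVec p)
    (hq : IsProbVec q) {l : ℝ} (hl : l ∈ Set.Icc (0 : ℝ) 1) :
    IsProbVec fun x => l * p x + (1 - l) * q x := by
  refine ⟨fun x => add_nonneg (mul_nonneg hl.1 (hp.1 x))
    (mul_nonneg (sub_nonneg.mpr hl.2) (hq.1 x)), ?_⟩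
  rw [sum_add_distrib, ← mul_sum, ← mul_sum, hp.2, hq.2]
  ring

theorem IsProbVec.sum_rpow_eq_of_renyiDiv_eq {X : Type*} [Fintype X] {α : ℝ} (hα : α ≠ 1)
    {p p' q : X → ℝ} (hp : IsProbVec p) (hp' : IsProbVec p') (hq : ∀ x, 0 < q x)
    (h : renyiDiv α p q = renyiDiv α p' q) :
    ∑ x, p x ^ α * q x ^ (1 - α) = ∑ x, p' x ^ α * q x ^ (1 - α) :=
  log_injOn_pos (hp.sum_rpow_mul_rpow_pos hq _ _) (hp'.sum_rpow_mul_rpow_pos hq _ _)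
    (mul_left_cancel₀ (one_div_ne_zero (sub_ne_zero.mpr hα)) h)

theorem renyiDiv_hemivariate_fst
    {X : Type*} [Fintype X]
    (α : ℝ) (hα0 : 0 < α) (hα1 : α ≠ 1)
    (Q : X → ℝ) (hQ : IsProbVec Q) (hQpos : ∀ x, 0 < Q x)
    (P₀ P₁ : X → ℝ) (hP₀ : IsProbVec P₀) (hP₁ : IsProbVec P₁) (hne : P₀ ≠ P₁) :
    ∃ l₁ ∈ Set.Icc (0 : ℝ) 1, ∃ l₂ ∈ Set.Icc (0 : ℝ) 1,
      renyiDiv α (fun x => l₁ * P₀ x + (1 - l₁) * P₁ x) Q ≠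
      renyiDiv α (fun x => l₂ * P₀ x + (1 - l₂) * P₁ x) Q := by
  by_contra! hconst
  have hmid : (1 / 2 : ℝ) ∈ Set.Icc (0 : ℝ) 1 := by norm_num
  have hsum (l : ℝ) (hl : l ∈ Set.Icc (0 : ℝ) 1) :=
    (hP₀.mix hP₁ hmid).sum_rpow_eq_of_renyiDiv_eq hα1 (hP₀.mix hP₁ hl) hQpos
      (hconst _ hmid l hl)
  have h₀ := hsum 1 (by norm_num)
  have h₁ := hsum 0 (by norm_num)
  norm_num at h₀ h₁
  have hw (x : X) : 0 < Q x ^ (1 - α) := rpow_pos_of_pos (hQpos x) _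
  have hm₀ : P₀ ∈ Set.univ.pi fun _ : X => Set.Ici (0 : ℝ) := fun x _ => hP₀.1 x
  have hm₁ : P₁ ∈ Set.univ.pi fun _ : X => Set.Ici (0 : ℝ) := fun x _ => hP₁.1 x
  have hpos : (0 : ℝ) < 1 / 2 := by norm_num
  have hadd : (1 / 2 : ℝ) + 1 / 2 = 1 := by norm_num
  rcases hα1.lt_or_gt with hα | hα
  · have h := ((strictConcaveOn_rpow hα0 hα).sum_apply_mul hw).2 hm₀ hm₁ hne hpos hpos hadd
    norm_num at h
    linarith
  · have h := ((strictConvexOn_rpow hα).sum_apply_mul hw).2 hm₀ hm₁ hne hpos hpos hadd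
    norm_num at h
    linarith
end
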